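/- Let S be a nonempty compact connected topological 2-manifold without boundary and let f : S → S³ be a topological embedding into the 3-sphere S³ (the unit sphere in 4-dimensional Euclidean space). Then the complement S³ \ f(S) of the image is not connected; that is, every closed surface embedded in the 3-sphere is separating. (This is the key claim in step 1 of the paper's Algorithm 1: cutting the knot complement along the closed normal surface S yields exactly two compact pieces M₁ and M₂, one on each side of S.) -/

import Mathlib

namespace SurfaceSeparation

open Set Filter Topology

lemma isInducing_circle_coe : IsInducing (fun z : Circle => (z : ℂ)) := ⟨rfl⟩

lemma continuous_circle_coe : Continuous (fun z : Circle => (z : ℂ)) :=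
  isInducing_circle_coe.continuous

/-- The direction of a complex number, with the value `1` at `0`. -/
noncomputable def dir (z : ℂ) : Circle := Circle.exp z.arg

lemma norm_mul_dir (z : ℂ) : (‖z‖ : ℂ) * (dir z : ℂ) = z := by
  rw [dir, Circle.coe_exp, Complex.norm_mul_exp_arg_mul_I]

lemma dir_eq_of_eq_mul {z : ℂ} {r : ℝ} (hr : 0 < r) {u : Circle} (h : z = r * u) :
    dir z = u := by
  have hn : ‖z‖ = r := by
    rw [h, norm_mul, Circle.norm_coe, mul_one, Complex.norm_real, Real.norm_of_nonneg hr.le]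
  have h2 := norm_mul_dir z
  rw [hn] at h2
  rw [h] at h2
  have h3 : (r : ℂ) ≠ 0 := by exact_mod_cast hr.ne'
  apply Circle.coe_injective
  rw [← h] at h2
  exact mul_left_cancel₀ h3 (h2.trans h)

lemma dir_mul {z w : ℂ} (hz : z ≠ 0) (hw : w ≠ 0) : dir (z * w) = dir z * dir w := by
  apply dir_eq_of_eq_mul (r := ‖z‖ * ‖w‖) (by positivity)
  conv_lhs => rw [← norm_mul_dir z, ← norm_mul_dir w]
  push_cast
  ring

lemma dir_coe (u : Circle) : dir (u : ℂ) = u :=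
  dir_eq_of_eq_mul one_pos (by simp)

lemma continuousAt_dir {z : ℂ} (hz : z ≠ 0) : ContinuousAt dir z := by
  rw [isInducing_circle_coe.continuousAt_iff]
  have : (fun w : ℂ => w / (‖w‖ : ℂ)) =ᶠ[𝓝 z] ((fun z : Circle => (z : ℂ)) ∘ dir) := by
    filter_upwards [isOpen_ne.mem_nhds hz] with w hw
    have h : (‖w‖ : ℂ) ≠ 0 := by simpa using hw
    rw [div_eq_iff h, mul_comm]
    exact (norm_mul_dir w).symm
  refine ContinuousAt.congr ?_ this
  refine ContinuousAt.div continuousAt_id (by fun_prop) (by simpa using hz)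

lemma exists_lift {A : Type*} [TopologicalSpace A] [SimplyConnectedSpace A]
    [LocallyPathConnectedSpace A] (f : A → Circle) (hf : Continuous f) (a : A) :
    ∃ L : A → ℝ, Continuous L ∧ ∀ x, Circle.exp (L x) = f x := by
  obtain ⟨F, ⟨-, hF⟩, -⟩ := Circle.isCoveringMap_exp.existsUnique_continuousMap_lifts ⟨f, hf⟩ a
    _ (Circle.exp_arg (f a))
  exact ⟨F, F.continuous, fun x => congrFun hF x⟩

/-- A circle-valued function has a continuous square root on a punctured neighbourhood of `p`. -/
def IsSqAt {X : Type*} [TopologicalSpace X] (φ : X → Circle) (p : X) : Prop :=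
  ∃ ψ : X → Circle, ∀ᶠ x in 𝓝[≠] p, ContinuousAt ψ x ∧ ψ x ^ 2 = φ x

section IsSqAt

variable {X : Type*} [TopologicalSpace X] {φ χ : X → Circle} {p : X}

lemma IsSqAt.mul (h : IsSqAt φ p) (h' : IsSqAt χ p) : IsSqAt (φ * χ) p := by
  obtain ⟨ψ, h⟩ := h
  obtain ⟨ψ', h'⟩ := h'
  refine ⟨ψ * ψ', ?_⟩
  filter_upwards [h, h'] with x h h'
  exact ⟨h.1.mul h'.1, by simp [mul_pow, h.2, h'.2]⟩

lemma IsSqAt.inv (h : IsSqAt φ p) : IsSqAt φ⁻¹ p := by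
  obtain ⟨ψ, h⟩ := h
  refine ⟨ψ⁻¹, ?_⟩
  filter_upwards [h] with x h
  exact ⟨h.1.inv, by simp [h.2]⟩

lemma IsSqAt.congr (h : IsSqAt φ p) (h' : ∀ᶠ x in 𝓝[≠] p, φ x = χ x) : IsSqAt χ p := by
  obtain ⟨ψ, h⟩ := h
  refine ⟨ψ, ?_⟩
  filter_upwards [h, h'] with x h h'
  exact ⟨h.1, h.2.trans h'⟩

lemma isSqAt_exp {g : X → ℝ} (h : ∀ᶠ x in 𝓝[≠] p, ContinuousAt g x) :
    IsSqAt (fun x => Circle.exp (g x)) p := by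
  refine ⟨fun x => Circle.exp (g x / 2), ?_⟩
  filter_upwards [h] with x h
  refine ⟨Circle.exp.continuous.continuousAt.comp (h.div_const 2), ?_⟩
  rw [pow_two, ← Circle.exp_add]
  ring_nf

/-- A continuous circle-valued function has local logarithms. -/
lemma exists_local_log (h : ∀ᶠ x in 𝓝 p, ContinuousAt φ x) :
    ∃ g : X → ℝ, ∀ᶠ x in 𝓝 p, ContinuousAt g x ∧ φ x = Circle.exp (g x) := by
  refine ⟨fun x => Complex.arg (φ x / φ p : ℂ) + Complex.arg (φ p), ?_⟩
  have h1 : ContinuousAt (fun x => (φ x / φ p : ℂ)) p :=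
    (continuous_circle_coe.continuousAt.comp h.self_of_nhds).div_const _
  have h2 : ∀ᶠ x in 𝓝 p, (φ x / φ p : ℂ) ∈ Complex.slitPlane := by
    apply h1.eventually_mem
    apply Complex.isOpen_slitPlane.mem_nhds
    simp
  filter_upwards [h, h2] with x hx hx2
  constructor
  · refine ContinuousAt.add ?_ continuousAt_const
    refine ContinuousAt.comp (f := fun x => (φ x / φ p : ℂ)) (Complex.continuousAt_arg hx2) ?_
    exact (continuous_circle_coe.continuousAt.comp hx).div_const _
  · rw [Circle.exp_add, ← Circle.coe_div, Circle.exp_arg, Circle.exp_arg, div_mul_cancel]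

lemma isSqAt_of_continuousAt (h : ∀ᶠ x in 𝓝 p, ContinuousAt φ x) : IsSqAt φ p := by
  obtain ⟨g, hg⟩ := exists_local_log h
  have hg' := hg.filter_mono (nhdsWithin_le_nhds (s := {p}ᶜ))
  exact (isSqAt_exp (hg'.mono fun x hx => hx.1)).congr (hg'.mono fun x hx => hx.2.symm)

end IsSqAt

lemma even_of_sq_eq_dir_zpow {n : ℤ} {r : ℝ} (hr : 0 < r) {s : ℂ → Circle}
    (hs : ∀ z, ‖z‖ = r → ContinuousAt s z) (h : ∀ z, ‖z‖ = r → s z ^ 2 = dir z ^ n) :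
    Even n := by
  set c : ℝ → ℂ := fun θ => r * (Circle.exp θ : ℂ) with hc
  have hcn : ∀ θ, ‖c θ‖ = r := fun θ => by
    simp [hc, abs_of_pos hr]
  have hcc : Continuous c := by
    have := continuous_circle_coe.comp Circle.exp.continuous
    exact continuous_const.mul this
  set u : ℝ → Circle := fun θ => s (c θ) * Circle.exp (-(n * θ / 2)) with hu
  have huc : Continuous u := by
    rw [continuous_iff_continuousAt]
    intro θ
    refine ContinuousAt.mul ((hs _ (hcn θ)).comp hcc.continuousAt) ?_
    exact (Circle.exp.continuous.comp (by fun_prop)).continuousAt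
  have hu2 : ∀ θ, u θ ^ 2 = 1 := fun θ => by
    have h1 : dir (c θ) = Circle.exp θ := dir_eq_of_eq_mul hr rfl
    simp only [hu]
    rw [mul_pow, h _ (hcn θ), h1, ← Circle.exp_zsmul, pow_two, ← Circle.exp_add, ← Circle.exp_add]
    rw [Circle.exp_eq_one]
    exact ⟨0, by simp; ring⟩
  have key : u 0 = u (2 * Real.pi) := by
    have := isPreconnected_univ.eq_or_eq_neg_of_sq_eq (S := univ)
      (f := fun θ => (u θ : ℂ)) (g := fun _ => (1 : ℂ))
      (continuous_circle_coe.comp huc).continuousOn continuousOn_const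
      (fun θ _ => by
        have := congrArg (fun x : Circle => (x : ℂ)) (hu2 θ)
        simpa using this) (fun _ => one_ne_zero)
    apply Circle.coe_injective
    rcases this with h | h
    · exact (h (mem_univ 0)).trans (h (mem_univ (2 * Real.pi))).symm
    · exact (h (mem_univ 0)).trans (h (mem_univ (2 * Real.pi))).symm
  have hc2 : c 0 = c (2 * Real.pi) := by simp [hc]
  simp only [hu, hc2] at key
  have key2 := mul_left_cancel key
  rw [Circle.exp_eq_exp] at key2
  obtain ⟨m, hm⟩ := key2
  refine ⟨m, ?_⟩
  have hpi := Real.pi_pos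
  have : (n : ℝ) * Real.pi = (m + m) * Real.pi := by linarith
  have := mul_right_cancel₀ hpi.ne' this
  exact_mod_cast this

lemma dir_sub_continuousAt {p z : ℂ} (h : z ≠ p) : ContinuousAt (fun z => dir (z - p)) z :=
  ContinuousAt.comp (f := fun z => z - p) (continuousAt_dir (sub_ne_zero.2 h)) (by fun_prop)

lemma isSqAt_dir_zpow {n : ℤ} {p : ℂ} : IsSqAt (fun z => dir (z - p) ^ n) p ↔ Even n := by
  constructor
  · rintro ⟨ψ, h⟩
    rw [eventually_nhdsWithin_iff, Metric.eventually_nhds_iff] at h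
    obtain ⟨ε, hε, h⟩ := h
    have h' : ∀ z : ℂ, ‖z‖ = ε / 2 → ContinuousAt ψ (z + p) ∧ ψ (z + p) ^ 2 = dir z ^ n := by
      intro z hz
      have := @h (z + p) (by simp [dist_eq_norm, hz, hε]) (by
        have : z ≠ 0 := by
          rintro rfl
          rw [norm_zero] at hz
          linarith
        simpa using this)
      simpa using this
    refine even_of_sq_eq_dir_zpow (r := ε / 2) (by positivity) (s := fun z => ψ (z + p)) ?_
      (fun z hz => (h' z hz).2)
    intro z hz
    exact ContinuousAt.comp (f := fun z => z + p) (h' z hz).1 (by fun_prop)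
  · rintro ⟨m, rfl⟩
    refine ⟨fun z => dir (z - p) ^ m, ?_⟩
    filter_upwards [self_mem_nhdsWithin] with z hz
    exact ⟨(dir_sub_continuousAt hz).zpow m, by rw [zpow_add, pow_two]⟩

/-- A circle-valued function on a punctured disc is a power of the direction times an
exponential. -/
lemma exists_punctured_form {φ : ℂ → Circle} {p : ℂ} {ε : ℝ} (hε : 0 < ε)
    (h : ∀ z, z ≠ p → ‖z - p‖ < ε → ContinuousAt φ z) :
    ∃ (n : ℤ) (g : ℂ → ℝ), ∀ z, z ≠ p → ‖z - p‖ < ε →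
      ContinuousAt g z ∧ φ z = dir (z - p) ^ n * Circle.exp (g z) := by
  set ρ : ℂ → ℝ := fun w => Real.exp (Real.log ε - Real.exp w.re) with hρ
  set E : ℂ → ℂ := fun w => (ρ w : ℂ) * (Circle.exp w.im : ℂ) with hE
  have hρ0 : ∀ w, 0 < ρ w := fun w => Real.exp_pos _
  have hEn : ∀ w, ‖E w‖ = ρ w := fun w => by simp [hE, abs_of_pos (hρ0 w)]
  have hE0 : ∀ w, E w ≠ 0 := fun w => by
    rw [← norm_pos_iff, hEn]; exact hρ0 w
  have hρε : ∀ w, ρ w < ε := fun w => by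
    calc ρ w < Real.exp (Real.log ε) := Real.exp_lt_exp.2 (by linarith [Real.exp_pos w.re])
      _ = ε := Real.exp_log hε
  have hEc : Continuous E := by
    refine Continuous.mul ?_ ?_
    · exact Complex.continuous_ofReal.comp (by fun_prop)
    · exact continuous_circle_coe.comp (Circle.exp.continuous.comp Complex.continuous_im)
  have hEdir : ∀ w, dir (E w) = Circle.exp w.im := fun w => dir_eq_of_eq_mul (hρ0 w) rfl
  have hfc : Continuous fun w => φ (p + E w) := by
    rw [continuous_iff_continuousAt]
    intro w
    refine ContinuousAt.comp (f := fun w => p + E w) (h _ ?_ ?_)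
      (continuous_const.add hEc).continuousAt
    · simpa using hE0 w
    · simpa [hEn] using hρε w
  obtain ⟨L, hLc, hL⟩ := exists_lift _ hfc 0
  have hEper : ∀ w, E (w + 2 * Real.pi * Complex.I) = E w := fun w => by
    have h1 : (w + 2 * Real.pi * Complex.I).re = w.re := by simp
    have h2 : (w + 2 * Real.pi * Complex.I).im = w.im + 2 * Real.pi := by simp
    simp only [hE, hρ, h1, h2, Circle.exp_add, Circle.exp_two_pi, mul_one]
  obtain ⟨n, hn⟩ : ∃ n : ℤ, L (0 + 2 * Real.pi * Complex.I) = L 0 + n * (2 * Real.pi) := by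
    rw [← Circle.exp_eq_exp, hL, hL, hEper]
  have hLper : (fun w => L (w + 2 * Real.pi * Complex.I)) = fun w => L w + n * (2 * Real.pi) := by
    refine Circle.isCoveringMap_exp.eq_of_comp_eq ?_ ?_ ?_ (0 : ℂ) hn
    · exact hLc.comp (by fun_prop)
    · exact hLc.add continuous_const
    · funext w
      simp only [Function.comp]
      rw [hL, hEper, Circle.exp_add, hL, Circle.exp_eq_one.2 ⟨n, rfl⟩, mul_one]
  set G : ℂ → ℝ := fun w => L w - n * w.im with hG
  have hGc : Continuous G := by fun_prop
  have hGper : Function.Periodic G (2 * Real.pi * Complex.I) := fun w => by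
    have h1 : L (w + 2 * Real.pi * Complex.I) = _ := congrFun hLper w
    simp only [hG, h1]
    simp
    ring
  have hGexp : ∀ w, φ (p + E w) = dir (E w) ^ n * Circle.exp (G w) := fun w => by
    rw [hEdir, ← Circle.exp_zsmul, ← Circle.exp_add, ← hL]
    congr 1
    simp [hG]
  set inv : ℂ → ℂ → ℂ := fun a z =>
    ((Real.log (Real.log ε - Real.log ‖z - p‖) : ℝ) : ℂ) +
      ((Complex.arg ((z - p) / a) + Complex.arg a : ℝ) : ℂ) * Complex.I with hinv
  have hinvre : ∀ a z, (inv a z).re = Real.log (Real.log ε - Real.log ‖z - p‖) := by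
    intro a z
    simp only [hinv, Complex.add_re, Complex.re_ofReal_mul, Complex.I_re, Complex.ofReal_re]
    ring
  have hinvim : ∀ a z, (inv a z).im = Complex.arg ((z - p) / a) + Complex.arg a := by
    intro a z
    simp only [hinv, Complex.add_im, Complex.im_ofReal_mul, Complex.I_im, Complex.ofReal_im]
    ring
  have hinvexp : ∀ a z, a ≠ 0 → z ≠ p → Circle.exp (inv a z).im = dir (z - p) := by
    intro a z ha hz
    rw [hinvim, Circle.exp_add]
    change dir _ * dir _ = _
    rw [← dir_mul (div_ne_zero (sub_ne_zero.2 hz) ha) ha, div_mul_cancel₀ _ ha]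
  have hinvE : ∀ z, z ≠ p → ‖z - p‖ < ε → p + E (inv 1 z) = z := by
    intro z hz hzε
    have h0 : 0 < ‖z - p‖ := norm_pos_iff.2 (sub_ne_zero.2 hz)
    have h1 : ρ (inv 1 z) = ‖z - p‖ := by
      simp only [hρ]
      rw [hinvre, Real.exp_log (sub_pos.2 (Real.log_lt_log h0 hzε)), sub_sub_cancel,
        Real.exp_log h0]
    simp only [hE]
    rw [h1, hinvexp 1 z one_ne_zero hz, norm_mul_dir]
    ring
  have hGinv : ∀ a z, a ≠ 0 → z ≠ p → G (inv a z) = G (inv 1 z) := by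
    intro a z ha hz
    have h1 := (hinvexp a z ha hz).trans (hinvexp 1 z one_ne_zero hz).symm
    rw [Circle.exp_eq_exp] at h1
    obtain ⟨m, hm⟩ := h1
    have : inv a z = inv 1 z + m * (2 * Real.pi * Complex.I) := by
      apply Complex.ext
      · simp [hinvre]
      · rw [hm]; simp
    rw [this]
    exact hGper.int_mul m _
  refine ⟨n, fun z => G (inv 1 z), fun z hz hzε => ⟨?_, ?_⟩⟩
  · have ha : z - p ≠ 0 := sub_ne_zero.2 hz
    have h0 : 0 < ‖z - p‖ := norm_pos_iff.2 ha
    have hev : (fun y => G (inv (z - p) y)) =ᶠ[𝓝 z] fun y => G (inv 1 y) := by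
      filter_upwards [isOpen_ne.mem_nhds hz] with y hy
      exact hGinv _ y ha hy
    refine ContinuousAt.congr ?_ hev
    refine hGc.continuousAt.comp ?_
    have hlog : ContinuousAt (fun y : ℂ => Real.log (Real.log ε - Real.log ‖y - p‖)) z := by
      refine ContinuousAt.log ?_ (sub_pos.2 (Real.log_lt_log h0 hzε)).ne'
      refine continuousAt_const.sub (ContinuousAt.log (by fun_prop) h0.ne')
    have harg : ContinuousAt (fun y : ℂ => Complex.arg ((y - p) / (z - p))) z := by
      refine ContinuousAt.comp (f := fun y : ℂ => (y - p) / (z - p)) (Complex.continuousAt_arg ?_)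
        (by fun_prop)
      rw [div_self ha]
      simp
    exact (Complex.continuous_ofReal.continuousAt.comp hlog).add
      ((Complex.continuous_ofReal.continuousAt.comp (harg.add continuousAt_const)).mul
        continuousAt_const)
  · have := hGexp (inv 1 z)
    rw [hinvE z hz hzε] at this
    rw [this]
    congr 3
    rw [eq_sub_iff_add_eq', hinvE z hz hzε]

/-- A circle-valued function on the plane with finitely many singularities is a product of powers
of directions and an exponential. -/
lemma exists_global_form (F : Finset ℂ) : ∀ h : ℂ → Circle, (∀ z ∉ F, ContinuousAt h z) →
    ∃ (n : ℂ → ℤ) (G : ℂ → ℝ), ∀ z ∉ F,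
      ContinuousAt G z ∧ h z = (∏ p ∈ F, dir (z - p) ^ n p) * Circle.exp (G z) := by
  classical
  induction F using Finset.induction_on with
  | empty =>
    intro h hh
    obtain ⟨L, hLc, hL⟩ := exists_lift h
      (continuous_iff_continuousAt.2 fun z => hh z (Finset.notMem_empty z)) 0
    exact ⟨0, L, fun z _ => ⟨hLc.continuousAt, by simp [hL]⟩⟩
  | insert p F hpF ih =>
    intro h hh
    obtain ⟨ε, hε, hball⟩ : ∃ ε > 0, Metric.ball p ε ⊆ (F : Set ℂ)ᶜ :=
      Metric.isOpen_iff.1 F.finite_toSet.isClosed.isOpen_compl p (by simpa using hpF)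
    have hloc : ∀ z, z ≠ p → ‖z - p‖ < ε → ContinuousAt h z := by
      intro z hz hzε
      apply hh
      have := hball (show z ∈ Metric.ball p ε by simpa [dist_eq_norm] using hzε)
      simpa [hz] using this
    obtain ⟨m, g, hg⟩ := exists_punctured_form hε hloc
    set χ : ℂ → ℝ := fun z => min 1 (max 0 (2 * ‖z - p‖ / ε - 1 / 2)) with hχ
    have hχc : Continuous χ := by fun_prop
    have hχ0 : ∀ z, ‖z - p‖ < ε / 4 → χ z = 0 := by
      intro z hz
      have : 2 * ‖z - p‖ / ε - 1 / 2 ≤ 0 := by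
        rw [sub_nonpos, div_le_iff₀ hε]
        linarith
      change min 1 (max 0 (2 * ‖z - p‖ / ε - 1 / 2)) = 0
      rw [max_eq_left this, min_eq_right zero_le_one]
    have hχ1 : ∀ z, 3 / 4 * ε < ‖z - p‖ → χ z = 1 := by
      intro z hz
      have : 1 ≤ 2 * ‖z - p‖ / ε - 1 / 2 := by
        rw [le_sub_iff_add_le, le_div_iff₀ hε]
        linarith
      change min 1 (max 0 (2 * ‖z - p‖ / ε - 1 / 2)) = 1
      rw [min_eq_left (le_max_of_le_right this)]
    -- remove the singularity at `p`
    set g₀ : ℂ → ℝ := fun z => if ‖z - p‖ < ε then (1 - χ z) * g z else 0 with hg₀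
    have hg₀c : ∀ z, z ≠ p → ContinuousAt g₀ z := by
      intro z hz
      by_cases hzε : ‖z - p‖ < ε
      · have : (fun z => (1 - χ z) * g z) =ᶠ[𝓝 z] g₀ := by
          have ho : IsOpen {z : ℂ | ‖z - p‖ < ε} := isOpen_lt (by fun_prop) (by fun_prop)
          filter_upwards [ho.mem_nhds hzε] with y hy
          have hy' : ‖y - p‖ < ε := hy
          simp [hg₀, hy']
        exact ((continuous_const.sub hχc).continuousAt.mul (hg z hz hzε).1).congr this
      · have : (fun _ => (0 : ℝ)) =ᶠ[𝓝 z] g₀ := by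
          have ho : IsOpen {z : ℂ | 3 / 4 * ε < ‖z - p‖} := isOpen_lt (by fun_prop) (by fun_prop)
          filter_upwards [ho.mem_nhds (show 3 / 4 * ε < ‖z - p‖ by linarith)] with y hy
          simp [hg₀, hχ1 y hy]
        exact continuousAt_const.congr this
    set k : ℂ → Circle := fun z => if z = p then 1 else
      h z * (dir (z - p) ^ m)⁻¹ * Circle.exp (-g₀ z) with hk
    have hkc : ∀ z ∉ F, ContinuousAt k z := by
      intro z hzF
      by_cases hz : z = p
      · have : (fun _ => (1 : Circle)) =ᶠ[𝓝 z] k := by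
          have ho : IsOpen {z : ℂ | ‖z - p‖ < ε / 4} := isOpen_lt (by fun_prop) (by fun_prop)
          filter_upwards [ho.mem_nhds (show ‖z - p‖ < ε / 4 by simp [hz, hε])] with y hy
          simp only [hk]
          split_ifs with hyp
          · rfl
          · have hyε : ‖y - p‖ < ε := lt_trans hy (by linarith)
            rw [(hg y hyp hyε).2]
            simp only [hg₀, hyε, if_true, hχ0 y hy, Circle.exp_neg]
            rw [mul_assoc (dir _ ^ m), mul_comm (Circle.exp _), mul_inv_cancel_left]
            simp
        exact continuousAt_const.congr this
      · have : (fun z => h z * (dir (z - p) ^ m)⁻¹ * Circle.exp (-g₀ z)) =ᶠ[𝓝 z] k := by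
          filter_upwards [isOpen_ne.mem_nhds hz] with y hy
          simp only [hk, if_neg hy]
        refine ContinuousAt.congr ?_ this
        refine ((hh z ?_).mul ((dir_sub_continuousAt hz).zpow m).inv).mul
          (Circle.exp.continuous.continuousAt.comp (hg₀c z hz).neg)
        simp [hz, hzF]
    obtain ⟨n, G, hG⟩ := ih k hkc
    refine ⟨Function.update n p m, fun z => G z + g₀ z, fun z hz => ?_⟩
    rw [Finset.mem_insert, not_or] at hz
    refine ⟨(hG z hz.2).1.add (hg₀c z hz.1), ?_⟩
    rw [Finset.prod_insert hpF, Function.update_self]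
    have hprod : ∏ q ∈ F, dir (z - q) ^ Function.update n p m q = ∏ q ∈ F, dir (z - q) ^ n q := by
      refine Finset.prod_congr rfl fun q hq => ?_
      rw [Function.update_of_ne]
      rintro rfl
      exact hpF hq
    have h1 := (hG z hz.2).2
    simp only [hk, if_neg hz.1] at h1
    rw [hprod, mul_assoc, Circle.exp_add, ← mul_assoc (∏ q ∈ F, _), ← h1, Circle.exp_neg]
    rw [mul_assoc (h z * _), inv_mul_cancel, mul_one, mul_comm (h z), mul_inv_cancel_left]

/-- The number of singularities without local square root of a circle-valued function on the plane
which is trivial near infinity is even. -/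
lemma even_ncard_not_isSqAt_of_eq_one {h : ℂ → Circle} {F : Set ℂ} (hF : F.Finite)
    (hc : ∀ z ∉ F, ContinuousAt h z) {R : ℝ} (hR : ∀ z, R < ‖z‖ → h z = 1) :
    Even {p | ¬ IsSqAt h p}.ncard := by
  classical
  lift F to Finset ℂ using hF
  obtain ⟨n, G, hG⟩ := exists_global_form F h (by simpa using hc)
  have hsq : ∀ p ∈ F, (IsSqAt h p ↔ Even (n p)) := by
    intro p hp
    set rest : ℂ → Circle := fun z =>
      (∏ q ∈ F.erase p, dir (z - q) ^ n q) * Circle.exp (G z) with hrest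
    have hnear : ∀ᶠ z in 𝓝[≠] p, z ∉ F := by
      have : ((F.erase p : Finset ℂ) : Set ℂ)ᶜ ∈ 𝓝 p :=
        (F.erase p).finite_toSet.isClosed.isOpen_compl.mem_nhds (by simp)
      filter_upwards [nhdsWithin_le_nhds this, self_mem_nhdsWithin] with z hz hzp
      simp only [mem_compl_iff, Finset.coe_erase, Set.mem_sdiff, Finset.mem_coe, mem_singleton_iff,
        not_and, not_not] at hz
      exact fun hzF => hzp (hz hzF)
    have hrest_sq : IsSqAt rest p := by
      refine IsSqAt.mul (φ := fun z => ∏ q ∈ F.erase p, dir (z - q) ^ n q)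
        (χ := fun z => Circle.exp (G z)) (isSqAt_of_continuousAt ?_) (isSqAt_exp ?_)
      · have : ((F.erase p : Finset ℂ) : Set ℂ)ᶜ ∈ 𝓝 p :=
          (F.erase p).finite_toSet.isClosed.isOpen_compl.mem_nhds (by simp)
        filter_upwards [this] with z hz
        refine tendsto_finsetProd _ fun q hq => ?_
        refine ContinuousAt.zpow (dir_sub_continuousAt ?_) _
        rintro rfl
        exact hz hq
      · exact hnear.mono fun z hz => (hG z hz).1
    have hh : ∀ᶠ z in 𝓝[≠] p, h z = dir (z - p) ^ n p * rest z := by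
      filter_upwards [hnear] with z hz
      rw [(hG z hz).2, hrest, ← Finset.mul_prod_erase F _ hp, mul_assoc]
    rw [← isSqAt_dir_zpow (p := p)]
    constructor
    · intro hs
      refine (hs.mul hrest_sq.inv).congr ?_
      filter_upwards [hh] with z hz
      simp [hz]
    · intro hs
      refine (hs.mul hrest_sq).congr ?_
      filter_upwards [hh] with z hz
      simp [hz]
  have hset : {p | ¬ IsSqAt h p} = (F.filter fun p => Odd (n p) : Finset ℂ) := by
    ext p
    simp only [mem_ofPred_eq, Finset.coe_filter]
    by_cases hp : p ∈ F
    · simp [hp, hsq p hp]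
    · simp only [hp, false_and, iff_false, not_not]
      apply isSqAt_of_continuousAt
      filter_upwards [F.finite_toSet.isClosed.isOpen_compl.mem_nhds
        (show p ∈ ((F : Set ℂ))ᶜ by simpa using hp)] with z hz
      exact hc z hz
  rw [hset, ncard_coe_finset]
  have hcard : Even (∑ p ∈ F, n p) → Even (F.filter fun p => Odd (n p)).card := by
    intro h1
    have h2 : Even (∑ p ∈ F, (n p).natAbs) := by
      have h3 : ∀ s : Finset ℂ, Even (∑ p ∈ s, (n p).natAbs) ↔ Even (∑ p ∈ s, n p) := by
        intro s
        induction s using Finset.induction_on with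
        | empty => simp
        | insert a s ha ih =>
          rw [Finset.sum_insert ha, Finset.sum_insert ha, Nat.even_add, Int.even_add, ih,
            Int.natAbs_even]
      exact (h3 F).2 h1
    rw [Finset.even_sum_iff_even_card_odd] at h2
    simpa using h2
  apply hcard
  -- behaviour on a large circle
  obtain ⟨r, hr0, hrR, hrF⟩ : ∃ r : ℝ, 0 < r ∧ R < r ∧ ∀ p ∈ F, ‖p‖ < r := by
    obtain ⟨b, hb⟩ := (F.image fun p => ‖p‖).bddAbove
    refine ⟨max 0 (max R b) + 1, ?_, ?_, fun p hp => ?_⟩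
    · linarith [le_max_left 0 (max R b)]
    · linarith [le_max_right 0 (max R b), le_max_left R b]
    · have := hb (show ‖p‖ ∈ _ by simpa using ⟨p, hp, rfl⟩)
      linarith [le_max_right 0 (max R b), le_max_right R b]
  have hslit : ∀ z : ℂ, ‖z‖ = r → ∀ p ∈ F, 1 - p / z ∈ Complex.slitPlane := by
    intro z hz p hp
    left
    have h1 : ‖p / z‖ < 1 := by
      rw [norm_div, hz, div_lt_one hr0]
      exact hrF p hp
    have := (Complex.abs_re_le_norm (p / z)).trans_lt h1
    simp only [Complex.sub_re, Complex.one_re]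
    linarith [le_abs_self (p / z).re]
  have hz0 : ∀ z : ℂ, ‖z‖ = r → z ≠ 0 := by
    rintro z hz rfl
    rw [norm_zero] at hz
    exact hr0.ne hz
  have hzF : ∀ z : ℂ, ‖z‖ = r → z ∉ F := fun z hz hzF => (hrF z hzF).ne hz
  refine even_of_sq_eq_dir_zpow hr0 (s := fun z => Circle.exp
    ((-G z - ∑ p ∈ F, n p * Complex.arg (1 - p / z)) / 2)) ?_ ?_
  · intro z hz
    refine Circle.exp.continuous.continuousAt.comp ?_
    refine ContinuousAt.div_const (((hG z (hzF z hz)).1.neg).sub ?_) 2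
    refine tendsto_finsetSum _ fun p hp => ?_
    refine ContinuousAt.mul continuousAt_const ?_
    refine ContinuousAt.comp (f := fun z => 1 - p / z) (Complex.continuousAt_arg (hslit z hz p hp)) ?_
    exact continuousAt_const.sub (continuousAt_const.div continuousAt_id (hz0 z hz))
  · intro z hz
    have h1 := (hG z (hzF z hz)).2
    rw [hR z (hz ▸ hrR)] at h1
    have h2 : ∏ p ∈ F, dir (z - p) ^ n p =
        dir z ^ (∑ p ∈ F, n p) * Circle.exp (∑ p ∈ F, n p * Complex.arg (1 - p / z)) := by
      have h3 : ∀ s : Finset ℂ, s ⊆ F → ∏ p ∈ s, dir (z - p) ^ n p =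
          dir z ^ (∑ p ∈ s, n p) * Circle.exp (∑ p ∈ s, n p * Complex.arg (1 - p / z)) := by
        intro s
        induction s using Finset.induction_on with
        | empty => simp
        | insert a s ha ih =>
          intro hs
          have haF := hs (Finset.mem_insert_self a s)
          rw [Finset.prod_insert ha, Finset.sum_insert ha, Finset.sum_insert ha,
            ih ((Finset.subset_insert a s).trans hs), zpow_add, Circle.exp_add]
          have h4 : z - a = z * (1 - a / z) := by
            field_simp [hz0 z hz]
          have h5 : Circle.exp (n a * Complex.arg (1 - a / z)) = dir (1 - a / z) ^ n a := by
            rw [dir, ← Circle.exp_zsmul, zsmul_eq_mul]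
          rw [h5, h4, dir_mul (hz0 z hz) (Complex.slitPlane_ne_zero (hslit z hz a haF)), mul_zpow]
          exact mul_mul_mul_comm _ _ _ _
      exact h3 F subset_rfl
    rw [h2] at h1
    rw [pow_two, ← Circle.exp_add, add_halves, sub_eq_add_neg, Circle.exp_add, Circle.exp_neg,
      Circle.exp_neg]
    rw [← mul_inv, eq_comm, eq_inv_iff_mul_eq_one, h1, mul_assoc]
    congr 1
    exact mul_comm _ _

/-- Generic perturbation: a continuous map between spaces of the same dimension can be changed
near its zeros so that only finitely many of them are left. -/
lemma exists_perturbation_finite_zeros_self {E : Type*} [NormedAddCommGroup E] [NormedSpace ℝ E]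
    [FiniteDimensional ℝ E] {W K : Set E} (hW : IsOpen W) (hK : IsCompact K) (hKW : K ⊆ W)
    {φ : E → E} (hφ : ContinuousOn φ W) (hzero : ∀ x ∈ W, φ x = 0 → x ∈ K) :
    ∃ (ψ : E → E) (K' : Set E), IsCompact K' ∧ K' ⊆ W ∧ ContinuousOn ψ W ∧
      (∀ x ∉ K', ψ x = φ x) ∧ {x | x ∈ W ∧ ψ x = 0}.Finite := by
  have : ProperSpace E := FiniteDimensional.proper ℝ E
  obtain ⟨K₁, hK₁, hKK₁, hK₁W⟩ := exists_compact_between hK hW hKW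
  obtain ⟨K₂, hK₂, hK₁₂, hK₂W⟩ := exists_compact_between hK₁ hW hK₁W
  -- a lower bound for the norm on the collar
  obtain ⟨δ, hδ, hδφ⟩ : ∃ δ > 0, ∀ x ∈ K₂ \ interior K₁, δ ≤ ‖φ x‖ := by
    have hcomp : IsCompact (K₂ \ interior K₁) := hK₂.diff isOpen_interior
    rcases (K₂ \ interior K₁).eq_empty_or_nonempty with hemp | hne
    · exact ⟨1, one_pos, by simp [hemp]⟩
    · obtain ⟨x, hx, hmin⟩ := hcomp.exists_isMinOn hne
        ((hφ.mono (sdiff_subset.trans hK₂W)).norm)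
      refine ⟨‖φ x‖, norm_pos_iff.2 fun h0 => hx.2 (hKK₁ (hzero x (hK₂W hx.1) h0)), hmin⟩
  have hT : TietzeExtension E := TietzeExtension.of_tvs ℝ
  obtain ⟨φ', hφ'⟩ := ContinuousMap.exists_restrict_eq hK₂.isClosed
    ⟨K₂.domRestrict φ, (hφ.mono hK₂W).domRestrict⟩
  have hφ'eq : ∀ x ∈ K₂, φ' x = φ x := fun x hx => congrFun (congrArg DFunLike.coe hφ') ⟨x, hx⟩
  obtain ⟨P, hP, hPφ, -⟩ := φ'.continuous.exists_contDiff_approx 1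
    (continuous_const (y := δ / 2)) (fun _ => by positivity)
  -- a small regular value
  obtain ⟨c, hcδ, hc⟩ : ∃ c : E, ‖c‖ < δ / 2 ∧ ∀ x, P x = c → (fderiv ℝ P x).det ≠ 0 := by
    let _ : MeasurableSpace E := borel E
    have _ : BorelSpace E := ⟨rfl⟩
    have h0 := MeasureTheory.addHaar_image_eq_zero_of_det_fderivWithin_eq_zero
      (MeasureTheory.Measure.addHaar : MeasureTheory.Measure E) (f := P) (f' := fderiv ℝ P)
      (s := {x | (fderiv ℝ P x).det = 0})
      (fun x _ => ((hP.differentiable (by norm_num)) x).hasFDerivAt.hasFDerivWithinAt)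
      (fun x hx => hx)
    have h1 : ¬ Metric.ball (0 : E) (δ / 2) ⊆ P '' {x | (fderiv ℝ P x).det = 0} := by
      intro hsub
      have := MeasureTheory.measure_mono_null hsub h0
      exact (Metric.measure_ball_pos MeasureTheory.Measure.addHaar (0 : E)
        (half_pos hδ)).ne' this
    rw [not_subset] at h1
    obtain ⟨c, hc, hc'⟩ := h1
    exact ⟨c, by simpa using hc, fun x hx hdet => hc' ⟨x, hdet, hx⟩⟩
  obtain ⟨χ, hχ0, hχ1, hχI⟩ := exists_continuous_zero_one_of_isClosed
    (s := (interior K₂)ᶜ) (t := K₁) isOpen_interior.isClosed_compl hK₁.isClosed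
    (disjoint_left.2 fun x hx hx' => hx (hK₁₂ hx'))
  refine ⟨fun x => φ x + χ x • (P x - c - φ x), K₂, hK₂, hK₂W, ?_, ?_, ?_⟩
  · exact hφ.add (χ.continuous.continuousOn.smul
      ((hP.continuous.continuousOn.sub continuousOn_const).sub hφ))
  · intro x hx
    have : χ x = 0 := hχ0 fun h => hx (interior_subset h)
    simp [this]
  · have hsub : {x | x ∈ W ∧ φ x + χ x • (P x - c - φ x) = 0} ⊆ K₁ ∩ P ⁻¹' {c} := by
      rintro x ⟨hxW, hx⟩
      by_cases hx1 : x ∈ interior K₁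
      · have h1 := interior_subset hx1
        have h2 : χ x = 1 := hχ1 h1
        rw [h2, one_smul, add_sub_cancel] at hx
        exact ⟨h1, sub_eq_zero.1 hx⟩
      · exfalso
        by_cases hx2 : x ∈ K₂
        · have h1 := hδφ x ⟨hx2, hx1⟩
          have h2 : ‖P x - c - φ x‖ < δ := by
            have h3 := hPφ x
            rw [hφ'eq x hx2, dist_eq_norm] at h3
            calc ‖P x - c - φ x‖ = ‖(P x - φ x) - c‖ := by rw [sub_right_comm]
              _ ≤ ‖P x - φ x‖ + ‖c‖ := norm_sub_le _ _
              _ < δ := by linarith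
          have h4 : ‖φ x‖ ≤ ‖P x - c - φ x‖ := by
            have h5 := congrArg norm (add_eq_zero_iff_eq_neg.1 hx)
            rw [norm_neg, norm_smul, Real.norm_of_nonneg (hχI x).1] at h5
            exact h5.le.trans (mul_le_of_le_one_left (norm_nonneg _) (hχI x).2)
          linarith
        · have h1 : χ x = 0 := hχ0 fun h => hx2 (interior_subset h)
          rw [h1, zero_smul, add_zero] at hx
          exact hx1 (hKK₁ (hzero x hxW hx))
    refine Set.Finite.subset ?_ hsub
    have hcomp : IsCompact (K₁ ∩ P ⁻¹' {c}) :=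
      hK₁.inter_right (isClosed_singleton.preimage hP.continuous)
    by_contra hinf
    obtain ⟨x, hx, hacc⟩ := Set.Infinite.exists_accPt_of_subset_isCompact hinf hcomp subset_rfl
    rw [accPt_iff_frequently_nhdsNE] at hacc
    refine hacc ?_
    have hd := ((hP.differentiable (by norm_num)) x).hasFDerivAt
    have := hd.eventually_ne (c := c) ⟨_, ((fderiv ℝ P x).toContinuousLinearEquivOfDetNeZero
      (hc x hx.2)).antilipschitz⟩
    exact this.mono fun y hy hy' => hy hy'.2

lemma exists_perturbation_finite_zeros {E V : Type*} [NormedAddCommGroup E] [NormedSpace ℝ E]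
    [FiniteDimensional ℝ E] [NormedAddCommGroup V] [NormedSpace ℝ V] [FiniteDimensional ℝ V]
    (hEV : Module.finrank ℝ V = Module.finrank ℝ E)
    {W K : Set E} (hW : IsOpen W) (hK : IsCompact K) (hKW : K ⊆ W)
    {φ : E → V} (hφ : ContinuousOn φ W) (hzero : ∀ x ∈ W, φ x = 0 → x ∈ K) :
    ∃ (ψ : E → V) (K' : Set E), IsCompact K' ∧ K' ⊆ W ∧ ContinuousOn ψ W ∧
      (∀ x ∉ K', ψ x = φ x) ∧ {x | x ∈ W ∧ ψ x = 0}.Finite := by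
  let L : V ≃L[ℝ] E := ContinuousLinearEquiv.ofFinrankEq hEV
  obtain ⟨ψ, K', hK', hK'W, hψ, hψφ, hfin⟩ := exists_perturbation_finite_zeros_self hW hK hKW
    (φ := fun x => L (φ x)) (L.continuous.comp_continuousOn hφ)
    (fun x hx h0 => hzero x hx (by simpa using h0))
  refine ⟨fun x => L.symm (ψ x), K', hK', hK'W, L.symm.continuous.comp_continuousOn hψ,
    fun x hx => by simp [hψφ x hx], by simpa using hfin⟩

section Surface

variable {S : Type*} [TopologicalSpace S]

lemma IsSqAt.comp_chart {X Y : Type*} [TopologicalSpace X] [TopologicalSpace Y]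
    (e : OpenPartialHomeomorph X Y) {p : X} (hp : p ∈ e.source) {χ : Y → Circle}
    (h : IsSqAt χ (e p)) : IsSqAt (fun x => χ (e x)) p := by
  obtain ⟨ψ, h⟩ := h
  have ht : Tendsto e (𝓝[≠] p) (𝓝[≠] (e p)) := by
    refine tendsto_nhdsWithin_iff.2 ⟨(e.continuousAt hp).mono_left nhdsWithin_le_nhds, ?_⟩
    filter_upwards [nhdsWithin_le_nhds (e.open_source.mem_nhds hp), self_mem_nhdsWithin] with x hx hxp
    exact fun heq => hxp (e.injOn hx hp heq)
  refine ⟨fun x => ψ (e x), ?_⟩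
  filter_upwards [ht.eventually h, nhdsWithin_le_nhds (e.open_source.mem_nhds hp)] with x hx hxs
  exact ⟨ContinuousAt.comp hx.1 (e.continuousAt hxs), hx.2⟩

lemma isSqAt_comp_symm_iff {X Y : Type*} [TopologicalSpace X] [TopologicalSpace Y]
    (e : OpenPartialHomeomorph X Y) {p : X} (hp : p ∈ e.source) {φ : X → Circle} :
    IsSqAt (fun y => φ (e.symm y)) (e p) ↔ IsSqAt φ p := by
  constructor
  · intro h
    refine (h.comp_chart e hp).congr ?_
    filter_upwards [nhdsWithin_le_nhds (e.open_source.mem_nhds hp)] with x hx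
    rw [e.left_inv hx]
  · intro h
    refine IsSqAt.comp_chart e.symm (e.map_source hp) ?_
    rwa [e.left_inv hp]

/-- The index of a circle-valued function modulo two is additive. -/
lemma isSqAt_mul_of_not_plane {φ χ : ℂ → Circle} {p : ℂ}
    (hφ : ∀ᶠ z in 𝓝[≠] p, ContinuousAt φ z) (hχ : ∀ᶠ z in 𝓝[≠] p, ContinuousAt χ z)
    (h : ¬ IsSqAt φ p) (h' : ¬ IsSqAt χ p) : IsSqAt (φ * χ) p := by
  have hev := hφ.and hχ
  rw [eventually_nhdsWithin_iff, Metric.eventually_nhds_iff] at hev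
  obtain ⟨ε, hε, hev⟩ := hev
  simp only [dist_eq_norm] at hev
  obtain ⟨n, g, hg⟩ := exists_punctured_form hε (fun z hz hzε => (hev hzε hz).1)
  obtain ⟨m, k, hk⟩ := exists_punctured_form hε (fun z hz hzε => (hev hzε hz).2)
  have hnear : ∀ᶠ z in 𝓝[≠] p, z ≠ p ∧ ‖z - p‖ < ε := by
    filter_upwards [self_mem_nhdsWithin, nhdsWithin_le_nhds (Metric.ball_mem_nhds p hε)] with z h1 h2
    exact ⟨h1, by simpa [dist_eq_norm] using h2⟩
  have key : ∀ (ξ : ℂ → Circle) (n : ℤ) (g : ℂ → ℝ), (∀ z, z ≠ p → ‖z - p‖ < ε →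
      ContinuousAt g z ∧ ξ z = dir (z - p) ^ n * Circle.exp (g z)) → Even n → IsSqAt ξ p := by
    intro ξ n g hg hn
    refine ((isSqAt_dir_zpow.2 hn).mul
      (isSqAt_exp (hnear.mono fun z hz => (hg z hz.1 hz.2).1))).congr ?_
    exact hnear.mono fun z hz => (hg z hz.1 hz.2).2.symm
  have hn : Odd n := Int.not_even_iff_odd.1 fun hn => h (key _ n g hg hn)
  have hm : Odd m := Int.not_even_iff_odd.1 fun hm => h' (key _ m k hk hm)
  refine key _ (n + m) (fun z => g z + k z) (fun z hz hzε => ⟨?_, ?_⟩) (hn.add_odd hm)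
  · exact (hg z hz hzε).1.add (hk z hz hzε).1
  · rw [Pi.mul_apply, (hg z hz hzε).2, (hk z hz hzε).2, zpow_add, Circle.exp_add]
    exact mul_mul_mul_comm _ _ _ _

lemma isSqAt_mul_of_not {φ χ : S → Circle} {p : S} (e : OpenPartialHomeomorph S ℂ)
    (hp : p ∈ e.source)
    (hφ : ∀ᶠ z in 𝓝[≠] p, ContinuousAt φ z) (hχ : ∀ᶠ z in 𝓝[≠] p, ContinuousAt χ z)
    (h : ¬ IsSqAt φ p) (h' : ¬ IsSqAt χ p) : IsSqAt (φ * χ) p := by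
  rw [← isSqAt_comp_symm_iff e hp] at h h' ⊢
  have hpt := e.map_source hp
  have ht : Tendsto e.symm (𝓝[≠] (e p)) (𝓝[≠] p) := by
    refine tendsto_nhdsWithin_iff.2 ⟨?_, ?_⟩
    · have := e.symm.continuousAt hpt
      rw [ContinuousAt, e.left_inv hp] at this
      exact this.mono_left nhdsWithin_le_nhds
    · filter_upwards [nhdsWithin_le_nhds (e.open_target.mem_nhds hpt), self_mem_nhdsWithin]
        with x hx hxp
      rintro rfl
      exact hxp (e.right_inv hx).symm
  refine isSqAt_mul_of_not_plane ?_ ?_ h h'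
  · filter_upwards [ht.eventually hφ, nhdsWithin_le_nhds (e.open_target.mem_nhds hpt)] with z hz hzt
    exact ContinuousAt.comp hz (e.symm.continuousAt hzt)
  · filter_upwards [ht.eventually hχ, nhdsWithin_le_nhds (e.open_target.mem_nhds hpt)] with z hz hzt
    exact ContinuousAt.comp hz (e.symm.continuousAt hzt)

lemma even_ncard_symmDiff {α : Type*} {A B : Set α} (hA : A.Finite) (hB : B.Finite)
    (hA2 : Even A.ncard) (hB2 : Even B.ncard) : Even (symmDiff A B).ncard := by
  have h1 := ncard_inter_add_ncard_sdiff_eq_ncard A B hA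
  have h2 := ncard_inter_add_ncard_sdiff_eq_ncard B A hB
  have h3 : (symmDiff A B).ncard = (A \ B).ncard + (B \ A).ncard := by
    rw [Set.symmDiff_def]
    exact ncard_union_eq disjoint_sdiff_sdiff hA.sdiff hB.sdiff
  rw [inter_comm] at h2
  rw [h3]
  rw [← h1] at hA2
  rw [← h2] at hB2
  grind

lemma finite_not_isSqAt [T1Space S] {φ : S → Circle} {F : Set S} (hF : F.Finite)
    (hφ : ∀ x ∉ F, ContinuousAt φ x) : {p | ¬ IsSqAt φ p}.Finite := by
  refine hF.subset fun p hp => ?_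
  by_contra hpF
  refine hp (isSqAt_of_continuousAt ?_)
  filter_upwards [hF.isClosed.isOpen_compl.mem_nhds hpF] with x hx using hφ x hx

lemma eventually_continuousAt [T1Space S] {φ : S → Circle} {F : Set S} (hF : F.Finite)
    (hφ : ∀ x ∉ F, ContinuousAt φ x) (p : S) : ∀ᶠ x in 𝓝[≠] p, ContinuousAt φ x := by
  have : (F \ {p})ᶜ ∈ 𝓝 p := (hF.sdiff (t := {p})).isClosed.isOpen_compl.mem_nhds (by simp)
  filter_upwards [nhdsWithin_le_nhds this, self_mem_nhdsWithin] with x hx hxp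
  exact hφ x fun hxF => hx ⟨hxF, hxp⟩

lemma even_ncard_mul [T1Space S] (hS : ∀ x : S, ∃ e : OpenPartialHomeomorph S ℂ, x ∈ e.source)
    {φ χ : S → Circle} {F F' : Set S} (hF : F.Finite) (hF' : F'.Finite)
    (hφ : ∀ x ∉ F, ContinuousAt φ x) (hχ : ∀ x ∉ F', ContinuousAt χ x)
    (h : Even {p | ¬ IsSqAt φ p}.ncard) (h' : Even {p | ¬ IsSqAt χ p}.ncard) :
    Even {p | ¬ IsSqAt (φ * χ) p}.ncard := by
  have : {p | ¬ IsSqAt (φ * χ) p} = symmDiff {p | ¬ IsSqAt φ p} {p | ¬ IsSqAt χ p} := by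
    ext p
    obtain ⟨e, hp⟩ := hS p
    rw [Set.mem_symmDiff]
    simp only [Set.mem_ofPred_eq, not_not]
    constructor
    · intro hn
      by_cases h1 : IsSqAt φ p
      · exact Or.inr ⟨fun h2 => hn (h1.mul h2), h1⟩
      · refine Or.inl ⟨h1, ?_⟩
        by_contra h2
        exact hn (isSqAt_mul_of_not e hp (eventually_continuousAt hF hφ p)
          (eventually_continuousAt hF' hχ p) h1 h2)
    · rintro (⟨h1, h2⟩ | ⟨h1, h2⟩) hn
      · refine h1 ((hn.mul h2.inv).congr (Eventually.of_forall fun x => ?_))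
        simp
      · refine h1 ((hn.mul h2.inv).congr (Eventually.of_forall fun x => ?_))
        simp
  rw [this]
  exact even_ncard_symmDiff (finite_not_isSqAt hF hφ) (finite_not_isSqAt hF' hχ) h h'

/-- The parity statement for functions which are trivial outside a chart. -/
lemma even_ncard_of_chart [T2Space S] (e : OpenPartialHomeomorph S ℂ) {C : Set S}
    (hC : IsCompact C) (hCe : C ⊆ e.source) {h : S → Circle} {F : Set S} (hF : F.Finite)
    (hc : ∀ x ∉ F, ContinuousAt h x) (h1 : ∀ x ∉ C, h x = 1) :
    Even {p | ¬ IsSqAt h p}.ncard := by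
  classical
  have hCc : IsCompact (e '' C) := hC.image_of_continuousOn (e.continuousOn.mono hCe)
  set k : ℂ → Circle := fun z => if z ∈ e.target then h (e.symm z) else 1 with hk
  have hkC : ∀ z ∉ e '' C, k z = 1 := by
    intro z hz
    simp only [hk]
    split_ifs with hzt
    · exact h1 _ fun hzC => hz ⟨_, hzC, e.right_inv hzt⟩
    · rfl
  have hkt : ∀ z ∈ e.target, k =ᶠ[𝓝 z] fun y => h (e.symm y) := by
    intro z hz
    filter_upwards [e.open_target.mem_nhds hz] with y hy
    simp only [hk, if_pos hy]
  have hkc : ∀ z ∉ e '' (F ∩ e.source), ContinuousAt k z := by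
    intro z hz
    by_cases hzt : z ∈ e.target
    · refine ContinuousAt.congr ?_ (hkt z hzt).symm
      refine ContinuousAt.comp (hc _ fun hzF => hz ?_) (e.symm.continuousAt hzt)
      exact ⟨_, ⟨hzF, e.map_target hzt⟩, e.right_inv hzt⟩
    · have hzC : z ∉ e '' C := by
        rintro ⟨x, hx, rfl⟩
        exact hzt (e.map_source (hCe hx))
      refine continuousAt_const.congr (f := fun _ => (1 : Circle)) ?_
      filter_upwards [hCc.isClosed.isOpen_compl.mem_nhds hzC] with y hy
      exact (hkC y hy).symm
  obtain ⟨R, hR⟩ := hCc.isBounded.exists_norm_le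
  have hev := even_ncard_not_isSqAt_of_eq_one ((hF.inter_of_left e.source).image e) hkc (R := R)
    (fun z hz => hkC z fun hzC => (hR z hzC).not_gt hz)
  have hsub : {p | ¬ IsSqAt h p} ⊆ C := by
    intro p hp
    by_contra hpC
    refine hp (isSqAt_of_continuousAt ?_)
    have hop := hC.isClosed.isOpen_compl
    filter_upwards [hop.mem_nhds hpC] with x hx
    refine continuousAt_const.congr (f := fun _ => (1 : Circle)) ?_
    filter_upwards [hop.mem_nhds hx] with y hy using (h1 y hy).symm
  have himg : e '' {p | ¬ IsSqAt h p} = {p | ¬ IsSqAt k p} := by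
    have hiff : ∀ p ∈ e.source, (IsSqAt k (e p) ↔ IsSqAt h p) := by
      intro p hp
      rw [← isSqAt_comp_symm_iff e hp]
      have := hkt (e p) (e.map_source hp)
      exact ⟨fun hs => hs.congr (nhdsWithin_le_nhds this),
        fun hs => hs.congr (nhdsWithin_le_nhds this.symm)⟩
    ext z
    constructor
    · rintro ⟨p, hp, rfl⟩
      exact fun hs => hp ((hiff p (hCe (hsub hp))).1 hs)
    · intro hz
      have hzt : z ∈ e.target := by
        by_contra hzt
        have hzC : z ∉ e '' C := by
          rintro ⟨x, hx, rfl⟩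
          exact hzt (e.map_source (hCe hx))
        refine hz ⟨1, ?_⟩
        filter_upwards [nhdsWithin_le_nhds (hCc.isClosed.isOpen_compl.mem_nhds hzC)] with y hy
        exact ⟨continuousAt_const, by simp [hkC y hy]⟩
      refine ⟨e.symm z, fun hs => hz ?_, e.right_inv hzt⟩
      have := (hiff _ (e.map_target hzt)).2 hs
      rwa [e.right_inv hzt] at this
  rw [← himg, (e.injOn.mono (hsub.trans hCe)).ncard_image] at hev
  exact hev

end Surface

section ClosedSurface

variable {S : Type*} [TopologicalSpace S]

lemma exists_avoiding_interval {r : ℝ} (hr : 0 < r) {B : Set ℝ} (hB : B.Finite) :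
    ∃ s δ : ℝ, 0 < δ ∧ r < s - δ ∧ s + δ < 2 * r ∧ ∀ t ∈ B, t < s - δ ∨ s + δ < t := by
  obtain ⟨s, hs, hsB⟩ := ((Ioo_infinite (show r < 2 * r by linarith)).sdiff hB).nonempty
  have hop : IsOpen (Ioo r (2 * r) \ B) := isOpen_Ioo.sdiff hB.isClosed
  obtain ⟨ε, hε, hball⟩ := Metric.isOpen_iff.1 hop s ⟨hs, hsB⟩
  have hmem : ∀ t, |t - s| < ε → t ∈ Ioo r (2 * r) \ B := fun t ht => hball (by
    rwa [Metric.mem_ball, Real.dist_eq])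
  refine ⟨s, ε / 2, by linarith, (hmem (s - ε / 2) ?_).1.1, (hmem (s + ε / 2) ?_).1.2, ?_⟩
  · rw [abs_lt]; constructor <;> linarith
  · rw [abs_lt]; constructor <;> linarith
  · intro t ht
    by_contra! hcon
    refine (hmem t ?_).2 ht
    rw [abs_lt]; constructor <;> linarith

/-- Cutting off a circle-valued function inside a chart, keeping it trivial where it was. -/
lemma exists_fragment [T2Space S] (e : OpenPartialHomeomorph S ℂ) {c : ℂ} {r : ℝ} (hr : 0 < r)
    (hball : Metric.closedBall c (2 * r) ⊆ e.target) {φ : S → Circle} {F : Set S}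
    (hF : F.Finite) (hφ : ∀ x ∉ F, ContinuousAt φ x) {A : Set S} (hA : IsClosed A)
    (h1 : ∀ x ∈ A, φ x = 1) :
    ∃ (h : S → Circle) (F' : Set S), F'.Finite ∧ (∀ x ∉ F', ContinuousAt h x) ∧
      (∀ x ∉ e.symm '' Metric.closedBall c (2 * r), h x = 1) ∧ (∀ x ∈ A, h x = 1) ∧
      ∀ x ∈ e.symm '' Metric.closedBall c r, h x = φ x := by
  classical
  obtain ⟨s, δ, hδ, hrs, hs2, hav⟩ := exists_avoiding_interval hr
    ((hF.inter_of_left e.source).image fun q => ‖e q - c‖)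
  have hav' : ∀ x ∈ e.source, s - δ ≤ ‖e x - c‖ → ‖e x - c‖ ≤ s + δ → x ∉ F := by
    intro x hx h1 h2 hxF
    rcases hav _ ⟨x, ⟨hxF, hx⟩, rfl⟩ with h | h
    · exact h1.not_gt h
    · exact h2.not_gt h
  set ρ : ℝ → ℝ := fun t => max 0 (min 1 ((s + δ - t) / (2 * δ))) with hρ
  have hρc : Continuous ρ := by fun_prop
  have hρ0 : ∀ t, s + δ ≤ t → ρ t = 0 := fun t ht => by
    apply max_eq_left
    exact (min_le_right _ _).trans (div_nonpos_of_nonpos_of_nonneg (by linarith) (by linarith))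
  have hρ1 : ∀ t, t ≤ s - δ → ρ t = 1 := fun t ht => by
    have : 1 ≤ (s + δ - t) / (2 * δ) := by rw [le_div_iff₀ (by linarith)]; linarith
    simp only [hρ, min_eq_left this]
    norm_num
  have hρh : ∀ t, ρ t = 1 / 2 → t = s := fun t ht => by
    have h3 : (s + δ - t) / (2 * δ) = 1 / 2 := by
      simp only [hρ] at ht
      rcases max_cases (0 : ℝ) (min 1 ((s + δ - t) / (2 * δ))) with h | h <;>
      rcases min_cases (1 : ℝ) ((s + δ - t) / (2 * δ)) with h' | h' <;> linarith
    rw [div_eq_iff (by linarith)] at h3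
    linarith
  set τ : S → ℝ := fun x => if x ∈ e.source then ρ ‖e x - c‖ else 0 with hτ
  have hsub : ∀ t ≤ 2 * r, Metric.closedBall c t ⊆ e.target := fun t ht =>
    (Metric.closedBall_subset_closedBall ht).trans hball
  have hcomp : ∀ t ≤ 2 * r, IsCompact (e.symm '' Metric.closedBall c t) := fun t ht =>
    (isCompact_closedBall c t).image_of_continuousOn (e.symm.continuousOn.mono (hsub t ht))
  have hτ0 : ∀ x ∉ e.symm '' Metric.closedBall c (s + δ), τ x = 0 := by
    intro x hx
    simp only [hτ]
    split_ifs with hxs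
    · refine hρ0 _ ?_
      by_contra! hlt
      exact hx ⟨e x, by rw [Metric.mem_closedBall, dist_eq_norm]; exact hlt.le, e.left_inv hxs⟩
    · rfl
  have hτc : Continuous τ := by
    rw [continuous_iff_continuousAt]
    intro x
    by_cases hxs : x ∈ e.source
    · have : ContinuousAt (fun x => ρ ‖e x - c‖) x :=
        hρc.continuousAt.comp (((e.continuousAt hxs).sub continuousAt_const).norm)
      refine this.congr ?_
      filter_upwards [e.open_source.mem_nhds hxs] with y hy
      simp only [hτ, if_pos hy]
    · have hx : x ∉ e.symm '' Metric.closedBall c (s + δ) := by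
        rintro ⟨z, hz, rfl⟩
        exact hxs (e.map_target (hsub _ hs2.le hz))
      refine continuousAt_const.congr (f := fun _ => (0 : ℝ)) ?_
      filter_upwards [(hcomp _ hs2.le).isClosed.isOpen_compl.mem_nhds hx] with y hy
      exact (hτ0 y hy).symm
  set h0 : S → ℂ := fun x => τ x * φ x + (1 - τ x) with hh0
  have hh0c : ∀ x ∉ F, ContinuousAt h0 x := by
    intro x hx
    have h3 : ContinuousAt (fun x => (τ x : ℂ)) x :=
      (Complex.continuous_ofReal.comp hτc).continuousAt
    exact (h3.mul (continuous_circle_coe.continuousAt.comp (hφ x hx))).add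
      (continuousAt_const.sub h3)
  have hh0z : ∀ x, h0 x = 0 → x ∈ e.source ∧ ‖e x - c‖ = s ∧ (φ x : ℂ) = -1 := by
    intro x hx
    have hτn : 0 ≤ τ x := by
      simp only [hτ]
      split_ifs
      · exact le_max_left _ _
      · exact le_rfl
    have hτm : τ x ≤ 1 := by
      simp only [hτ]
      split_ifs
      · exact max_le zero_le_one (min_le_left _ _)
      · exact zero_le_one
    have h3 : (τ x : ℂ) * φ x = ((τ x - 1 : ℝ) : ℂ) := by
      push_cast
      linear_combination hx
    have h4 := congrArg norm h3
    rw [norm_mul, Circle.norm_coe, Complex.norm_real, Complex.norm_real, Real.norm_of_nonneg hτn,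
      Real.norm_of_nonpos (by linarith)] at h4
    have h5 : τ x = 1 / 2 := by linarith
    have hxs : x ∈ e.source := by
      by_contra hxs
      simp only [hτ, if_neg hxs] at h5
      norm_num at h5
    refine ⟨hxs, hρh _ ?_, ?_⟩
    · simpa only [hτ, if_pos hxs] using h5
    · rw [h5] at h3
      push_cast at h3
      linear_combination 2 * h3
  set W : Set ℂ := {z | s - δ < ‖z - c‖ ∧ ‖z - c‖ < s + δ} ∩ (e.target ∩ e.symm ⁻¹' Aᶜ) with hW
  have hWo : IsOpen W := by
    refine IsOpen.inter ?_ (e.symm.isOpen_inter_preimage hA.isOpen_compl)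
    have hn : Continuous fun z : ℂ => ‖z - c‖ := by fun_prop
    exact (isOpen_lt continuous_const hn).inter (isOpen_lt hn continuous_const)
  have hφe : ∀ z ∈ e.target, s - δ ≤ ‖z - c‖ → ‖z - c‖ ≤ s + δ → e.symm z ∉ F := by
    intro z hz h1 h2
    apply hav' _ (e.map_target hz) <;> rwa [e.right_inv hz]
  have hWc : ContinuousOn (fun z => h0 (e.symm z)) W := by
    intro z hz
    refine ContinuousAt.continuousWithinAt ?_
    exact ContinuousAt.comp (hh0c _ (hφe z hz.2.1 hz.1.1.le hz.1.2.le))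
      (e.symm.continuousAt hz.2.1)
  have hsph : Metric.sphere c s ⊆ e.target :=
    Metric.sphere_subset_closedBall.trans (hsub s (by linarith))
  set K : Set ℂ := Metric.sphere c s ∩ (fun z => (φ (e.symm z) : ℂ)) ⁻¹' {-1} with hK
  have hKc : IsCompact K := by
    refine (isCompact_sphere c s).of_isClosed_subset ?_ inter_subset_left
    refine ContinuousOn.preimage_isClosed_of_isClosed ?_ Metric.isClosed_sphere isClosed_singleton
    intro z hz
    have hzt := hsph hz
    rw [mem_sphere_iff_norm] at hz
    refine ContinuousAt.continuousWithinAt (continuous_circle_coe.continuousAt.comp ?_)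
    exact ContinuousAt.comp (hφ _ (hφe z hzt (by linarith) (by linarith)))
      (e.symm.continuousAt hzt)
  have hKW : K ⊆ W := by
    rintro z ⟨hz, hz1⟩
    have hzt := hsph hz
    rw [mem_sphere_iff_norm] at hz
    refine ⟨⟨by linarith, by linarith⟩, hzt, fun hzA => ?_⟩
    have hz1' : (φ (e.symm z) : ℂ) = -1 := hz1
    rw [h1 _ hzA] at hz1'
    norm_num at hz1'
  obtain ⟨ψ, K', hK'c, hK'W, hψc, hψ, hZ⟩ := exists_perturbation_finite_zeros_self hWo hKc hKW hWc
    (fun z hz hz0 => by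
      obtain ⟨-, h4, h5⟩ := hh0z _ hz0
      rw [e.right_inv hz.2.1] at h4
      exact ⟨mem_sphere_iff_norm.2 h4, h5⟩)
  set Z := {z | z ∈ W ∧ ψ z = 0} with hZdef
  have hK'comp : IsCompact (e.symm '' K') := hK'c.image_of_continuousOn
    (e.symm.continuousOn.mono fun z hz => (hK'W hz).2.1)
  set H : S → ℂ := fun x => if x ∈ e.source ∧ e x ∈ W then ψ (e x) else h0 x with hH
  have hH0 : ∀ x ∉ e.symm '' K', H x = h0 x := by
    intro x hx
    simp only [hH]
    split_ifs with hxW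
    · rw [hψ, e.left_inv hxW.1]
      exact fun hxK => hx ⟨_, hxK, e.left_inv hxW.1⟩
    · rfl
  have hHn : ∀ x, ¬ (x ∈ e.source ∧ e x ∈ W) → H x = h0 x := fun x hx => by
    simp only [hH, if_neg hx]
  have hHc : ∀ x ∉ F, ContinuousAt H x := by
    intro x hxF
    by_cases hxW : x ∈ e.source ∧ e x ∈ W
    · have h3 : ContinuousAt (fun x => ψ (e x)) x :=
        ContinuousAt.comp (hψc.continuousAt (hWo.mem_nhds hxW.2)) (e.continuousAt hxW.1)
      refine h3.congr ?_
      filter_upwards [e.open_source.mem_nhds hxW.1,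
        (e.continuousAt hxW.1).eventually_mem (hWo.mem_nhds hxW.2)] with y hy hyW
      simp only [hH, if_pos (And.intro hy hyW)]
    · have hx : x ∉ e.symm '' K' := by
        rintro ⟨z, hz, rfl⟩
        have hzt := (hK'W hz).2.1
        exact hxW ⟨e.map_target hzt, by rw [e.right_inv hzt]; exact hK'W hz⟩
      refine (hh0c x hxF).congr ?_
      filter_upwards [hK'comp.isClosed.isOpen_compl.mem_nhds hx] with y hy
      exact (hH0 y hy).symm
  have hHz : ∀ x, H x = 0 → x ∈ e.symm '' Z := by
    intro x hx
    by_cases hxW : x ∈ e.source ∧ e x ∈ W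
    · simp only [hH, if_pos hxW] at hx
      exact ⟨e x, ⟨hxW.2, hx⟩, e.left_inv hxW.1⟩
    · rw [hHn x hxW] at hx
      obtain ⟨h3, h4, h5⟩ := hh0z x hx
      refine absurd ⟨h3, hKW ⟨mem_sphere_iff_norm.2 h4, ?_⟩⟩ hxW
      rw [mem_preimage, e.left_inv h3]
      exact h5
  have hone : dir (1 : ℂ) = 1 := by simpa using dir_coe 1
  refine ⟨fun x => dir (H x), F ∪ e.symm '' Z, hF.union (hZ.image _), ?_, ?_, ?_, ?_⟩
  · intro x hx
    refine ContinuousAt.comp (g := dir) (continuousAt_dir fun h => hx (Or.inr (hHz x h)))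
      (hHc x fun h => hx (Or.inl h))
  · intro x hx
    have hxW : ¬ (x ∈ e.source ∧ e x ∈ W) := by
      rintro ⟨h3, h4⟩
      refine hx ⟨e x, ?_, e.left_inv h3⟩
      rw [Metric.mem_closedBall, dist_eq_norm]
      linarith [h4.1.2]
    have := hτ0 x fun hx' => hx (image_mono (Metric.closedBall_subset_closedBall hs2.le) hx')
    simp only [hHn x hxW, hh0, this]
    simpa using hone
  · intro x hx
    have hxW : ¬ (x ∈ e.source ∧ e x ∈ W) := by
      rintro ⟨h3, h4⟩
      refine h4.2.2 ?_
      rw [e.left_inv h3]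
      exact hx
    simp only [hHn x hxW, hh0, h1 x hx]
    simpa using hone
  · rintro _ ⟨z, hz, rfl⟩
    have hzt := hsub r (by linarith) hz
    rw [Metric.mem_closedBall, dist_eq_norm] at hz
    have hxW : ¬ (e.symm z ∈ e.source ∧ e (e.symm z) ∈ W) := by
      rintro ⟨h3, h4⟩
      rw [e.right_inv hzt] at h4
      linarith [h4.1.1]
    have h3 : τ (e.symm z) = 1 := by
      simp only [hτ, if_pos (e.map_target hzt), e.right_inv hzt]
      exact hρ1 _ (by linarith)
    simp only [hHn _ hxW, hh0, h3]
    simpa using dir_coe (φ (e.symm z))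

lemma even_ncard_of_cover [T2Space S]
    (hS : ∀ x : S, ∃ e : OpenPartialHomeomorph S ℂ, x ∈ e.source) (l : List (Set S))
    (hl : ∀ D ∈ l, ∃ (e : OpenPartialHomeomorph S ℂ) (c : ℂ) (r : ℝ), 0 < r ∧
      Metric.closedBall c (2 * r) ⊆ e.target ∧ D = e.symm '' Metric.closedBall c r) :
    ∀ (A : Set S) (φ : S → Circle) (F : Set S), F.Finite → (∀ x ∉ F, ContinuousAt φ x) →
      IsClosed A → (∀ x ∈ A, φ x = 1) → (∀ x, x ∈ A ∨ ∃ D ∈ l, x ∈ D) →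
      Even {p | ¬ IsSqAt φ p}.ncard := by
  induction l with
  | nil =>
    intro A φ F _ _ _ hA1 hcov
    have : φ = fun _ => 1 := funext fun x => hA1 x (by simpa using hcov x)
    have h2 : {p | ¬ IsSqAt φ p} = ∅ := by
      rw [this]
      ext p
      simpa using isSqAt_of_continuousAt (φ := fun _ : S => (1 : Circle))
        (Eventually.of_forall fun x => continuousAt_const)
    simp [h2]
  | cons D l ih =>
    intro A φ F hF hφ hA hA1 hcov
    obtain ⟨e, c, r, hr, hball, rfl⟩ := hl D (by simp)
    obtain ⟨h, F', hF', hc, hout, hhA, hin⟩ := exists_fragment e hr hball hF hφ hA hA1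
    have hcomp : ∀ t ≤ 2 * r, IsCompact (e.symm '' Metric.closedBall c t) := fun t ht =>
      (isCompact_closedBall c t).image_of_continuousOn
        (e.symm.continuousOn.mono ((Metric.closedBall_subset_closedBall ht).trans hball))
    have hk : ∀ x ∉ F ∪ F', ContinuousAt (φ * h⁻¹) x := fun x hx =>
      (hφ x fun h => hx (Or.inl h)).mul (hc x fun h => hx (Or.inr h)).inv
    have hke := ih (fun D hD => hl D (by simp [hD])) (A ∪ e.symm '' Metric.closedBall c r)
      (φ * h⁻¹) (F ∪ F') (hF.union hF') hk (hA.union (hcomp r (by linarith)).isClosed)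
      (by
        rintro x (hx | hx)
        · simp [hA1 x hx, hhA x hx]
        · simp [hin x hx])
      (fun x => by
        rcases hcov x with hx | ⟨D, hD, hx⟩
        · exact Or.inl (Or.inl hx)
        · rcases List.mem_cons.1 hD with rfl | hD
          · exact Or.inl (Or.inr hx)
          · exact Or.inr ⟨D, hD, hx⟩)
    have hhe : Even {p | ¬ IsSqAt h p}.ncard :=
      even_ncard_of_chart e (hcomp _ le_rfl) (by
        rintro _ ⟨z, hz, rfl⟩
        exact e.map_target (hball hz)) hF' hc hout
    have := even_ncard_mul hS (hF.union hF') hF' hk hc hke hhe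
    rwa [inv_mul_cancel_right] at this

/-- On a closed surface, a circle-valued function with finitely many discontinuities has an even
number of points at which it has no local square root. -/
theorem even_ncard_not_isSqAt [T2Space S] [CompactSpace S]
    (hS : ∀ x : S, ∃ e : OpenPartialHomeomorph S ℂ, x ∈ e.source) {φ : S → Circle} {F : Set S}
    (hF : F.Finite) (hφ : ∀ x ∉ F, ContinuousAt φ x) : Even {p | ¬ IsSqAt φ p}.ncard := by
  have hD : ∀ x : S, ∃ D ∈ 𝓝 x, ∃ (e : OpenPartialHomeomorph S ℂ) (c : ℂ) (r : ℝ), 0 < r ∧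
      Metric.closedBall c (2 * r) ⊆ e.target ∧ D = e.symm '' Metric.closedBall c r := by
    intro x
    obtain ⟨e, hx⟩ := hS x
    obtain ⟨ε, hε, hb⟩ := Metric.isOpen_iff.1 e.open_target (e x) (e.map_source hx)
    have hr : Metric.closedBall (e x) (2 * (ε / 4)) ⊆ e.target :=
      (Metric.closedBall_subset_ball (by linarith)).trans hb
    refine ⟨_, ?_, e, e x, ε / 4, by linarith, hr, rfl⟩
    filter_upwards [e.open_source.mem_nhds hx,
      (e.continuousAt hx).eventually_mem (Metric.closedBall_mem_nhds (e x) (ε := ε / 4)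
        (by linarith))] with y hy hy2
    exact ⟨e y, hy2, e.left_inv hy⟩
  choose D hDn hDe using hD
  obtain ⟨t, ht⟩ := CompactSpace.elim_nhds_subcover D hDn
  refine even_ncard_of_cover hS (t.toList.map D) ?_ ∅ φ F hF hφ isClosed_empty (by simp) ?_
  · intro C hC
    obtain ⟨x, -, rfl⟩ := List.mem_map.1 hC
    exact hDe x
  · intro x
    have : x ∈ ⋃ y ∈ t, D y := by rw [ht]; trivial
    simp only [mem_iUnion] at this
    obtain ⟨y, hy, hxy⟩ := this
    exact Or.inr ⟨D y, List.mem_map.2 ⟨y, by simpa using hy, rfl⟩, hxy⟩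

end ClosedSurface

section Spinor

/-- The Euclidean norm on `ℝ × ℂ`. -/
noncomputable def euclNorm (v : ℝ × ℂ) : ℝ := Real.sqrt (v.1 ^ 2 + Complex.normSq v.2)

lemma euclNorm_sq (v : ℝ × ℂ) : euclNorm v ^ 2 = v.1 ^ 2 + Complex.normSq v.2 :=
  Real.sq_sqrt (add_nonneg (sq_nonneg _) (Complex.normSq_nonneg _))

lemma euclNorm_nonneg (v : ℝ × ℂ) : 0 ≤ euclNorm v := Real.sqrt_nonneg _

lemma continuous_euclNorm : Continuous euclNorm :=
  Real.continuous_sqrt.comp ((continuous_fst.pow 2).add (Complex.continuous_normSq.comp continuous_snd))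

lemma norm_le_euclNorm (v : ℝ × ℂ) : ‖v‖ ≤ euclNorm v := by
  rw [Prod.norm_def, max_le_iff]
  constructor
  · apply Real.le_sqrt_of_sq_le
    rw [Real.norm_eq_abs, sq_abs]
    linarith [Complex.normSq_nonneg v.2]
  · apply Real.le_sqrt_of_sq_le
    rw [Complex.sq_norm]
    linarith [sq_nonneg v.1]

lemma euclNorm_sq_le (v : ℝ × ℂ) : euclNorm v ^ 2 ≤ 2 * ‖v‖ ^ 2 := by
  have h1 : v.1 ^ 2 ≤ ‖v‖ ^ 2 := by
    rw [← sq_abs, ← Real.norm_eq_abs]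
    exact pow_le_pow_left₀ (norm_nonneg _) (norm_fst_le v) 2
  have h2 : Complex.normSq v.2 ≤ ‖v‖ ^ 2 := by
    rw [← Complex.sq_norm]
    exact pow_le_pow_left₀ (norm_nonneg _) (norm_snd_le v) 2
  rw [euclNorm_sq]
  linarith

/-- `(a, b)` is an eigenvector, for the eigenvalue `euclNorm v`, of the traceless Hermitian matrix
with first row `v`. -/
def IsEig (v : ℝ × ℂ) (a b : ℂ) : Prop :=
  v.2 * b = (euclNorm v - v.1) * a ∧ starRingEnd ℂ v.2 * a = (euclNorm v + v.1) * b

lemma mul_conj_eq (v : ℝ × ℂ) :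
    v.2 * starRingEnd ℂ v.2 = ((euclNorm v : ℂ) ^ 2 - (v.1 : ℂ) ^ 2) := by
  rw [Complex.mul_conj]
  have := euclNorm_sq v
  have h2 : Complex.normSq v.2 = euclNorm v ^ 2 - v.1 ^ 2 := by linarith
  rw [h2]
  push_cast
  ring

lemma exists_isEig (v : ℝ × ℂ) : ∃ a b : ℂ, IsEig v a b ∧ (a ≠ 0 ∨ b ≠ 0) := by
  by_cases h : euclNorm v + v.1 = 0
  · have h2 : v.2 = 0 := by
      rw [← Complex.normSq_eq_zero]
      have := euclNorm_sq v
      rw [eq_neg_of_add_eq_zero_left h] at this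
      linarith
    have h' : (euclNorm v + v.1 : ℂ) = 0 := by exact_mod_cast h
    exact ⟨0, 1, ⟨by simp [h2], by simp [h']⟩, Or.inr one_ne_zero⟩
  · refine ⟨euclNorm v + v.1, starRingEnd ℂ v.2, ⟨?_, ?_⟩, Or.inl (by exact_mod_cast h)⟩
    · rw [mul_conj_eq]; ring
    · ring

lemma IsEig.step {u v : ℝ × ℂ} {a b : ℂ} (h : IsEig u a b) (hab : a ≠ 0 ∨ b ≠ 0)
    (huv : euclNorm (u - v) < euclNorm u) :
    IsEig v ((euclNorm v + v.1) * a + v.2 * b)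
      (starRingEnd ℂ v.2 * a + (euclNorm v - v.1) * b) ∧
    ((euclNorm v + v.1) * a + v.2 * b ≠ 0 ∨
      starRingEnd ℂ v.2 * a + (euclNorm v - v.1) * b ≠ 0) := by
  have hv := mul_conj_eq v
  refine ⟨⟨by linear_combination a * hv, by linear_combination b * hv⟩, ?_⟩
  by_contra! hcon
  obtain ⟨h1, h2⟩ := hcon
  have hw := mul_conj_eq (u - v)
  simp only [Prod.fst_sub, Prod.snd_sub, map_sub, Complex.ofReal_sub] at hw
  obtain ⟨h3, h4⟩ := h
  have hc : ((euclNorm u + euclNorm v) ^ 2 - euclNorm (u - v) ^ 2 : ℂ) ≠ 0 := by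
    have : 0 < (euclNorm u + euclNorm v) ^ 2 - euclNorm (u - v) ^ 2 := by
      nlinarith [euclNorm_nonneg u, euclNorm_nonneg v, euclNorm_nonneg (u - v)]
    exact_mod_cast this.ne'
  have e1 : (euclNorm u + euclNorm v - (u.1 - v.1) : ℂ) * a = (u.2 - v.2) * b := by
    linear_combination h1 - h3
  have e2 : (euclNorm u + euclNorm v + (u.1 - v.1) : ℂ) * b =
      (starRingEnd ℂ u.2 - starRingEnd ℂ v.2) * a := by
    linear_combination h2 - h4
  have e3 : ((euclNorm u + euclNorm v) ^ 2 - euclNorm (u - v) ^ 2 : ℂ) * a = 0 := by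
    linear_combination (euclNorm u + euclNorm v + (u.1 - v.1) : ℂ) * e1 + (u.2 - v.2) * e2 + a * hw
  have e4 : ((euclNorm u + euclNorm v) ^ 2 - euclNorm (u - v) ^ 2 : ℂ) * b = 0 := by
    linear_combination (euclNorm u + euclNorm v - (u.1 - v.1) : ℂ) * e2 +
      (starRingEnd ℂ u.2 - starRingEnd ℂ v.2) * e1 + b * hw
  rcases hab with h | h
  · exact h ((mul_eq_zero.1 e3).resolve_left hc)
  · exact h ((mul_eq_zero.1 e4).resolve_left hc)

/-- Maps from a ball to the nonzero vectors of a three-dimensional space lift to eigenvectors. -/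
lemma exists_spinor {E : Type*} [NormedAddCommGroup E] [NormedSpace ℝ E] [ProperSpace E] {R : ℝ}
    (hR : 0 < R) {Φ : E → ℝ × ℂ} (hc : ContinuousOn Φ (Metric.closedBall 0 R))
    (h0 : ∀ x ∈ Metric.closedBall (0 : E) R, Φ x ≠ 0) :
    ∃ φ₁ φ₂ : E → ℂ, ContinuousOn φ₁ (Metric.closedBall 0 R) ∧
      ContinuousOn φ₂ (Metric.closedBall 0 R) ∧
      ∀ x ∈ Metric.closedBall (0 : E) R, IsEig (Φ x) (φ₁ x) (φ₂ x) ∧ (φ₁ x ≠ 0 ∨ φ₂ x ≠ 0) := by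
  have hcpt := isCompact_closedBall (0 : E) R
  obtain ⟨x₀, hx₀, hmin⟩ := hcpt.exists_isMinOn ⟨0, by simp [hR.le]⟩ hc.norm
  set δ := ‖Φ x₀‖ with hδ
  have hδ0 : 0 < δ := norm_pos_iff.2 (h0 x₀ hx₀)
  obtain ⟨η, hη, huc⟩ := Metric.uniformContinuousOn_iff.1
    (hcpt.uniformContinuousOn_of_continuous hc) (δ / 2) (by linarith)
  obtain ⟨n, hn⟩ := exists_nat_gt (R / η)
  have hn0 : (0 : ℝ) < n := lt_of_le_of_lt (by positivity) hn
  have hRn : R / n < η := by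
    rw [div_lt_iff₀ hη] at hn
    rw [div_lt_iff₀ hn0]
    linarith
  have hmem : ∀ k : ℕ, k ≤ n → ∀ x ∈ Metric.closedBall (0 : E) R,
      ((k : ℝ) / n) • x ∈ Metric.closedBall (0 : E) R := by
    intro k hk x hx
    rw [mem_closedBall_zero_iff] at hx ⊢
    rw [norm_smul, Real.norm_of_nonneg (by positivity)]
    have : (k : ℝ) / n ≤ 1 := by
      rw [div_le_one hn0]
      exact_mod_cast hk
    calc (k : ℝ) / n * ‖x‖ ≤ 1 * R := by gcongr
      _ = R := one_mul R
  have key : ∀ k : ℕ, k ≤ n → ∃ φ₁ φ₂ : E → ℂ, ContinuousOn φ₁ (Metric.closedBall 0 R) ∧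
      ContinuousOn φ₂ (Metric.closedBall 0 R) ∧ ∀ x ∈ Metric.closedBall (0 : E) R,
        IsEig (Φ (((k : ℝ) / n) • x)) (φ₁ x) (φ₂ x) ∧ (φ₁ x ≠ 0 ∨ φ₂ x ≠ 0) := by
    intro k
    induction k with
    | zero =>
      intro _
      obtain ⟨a, b, h⟩ := exists_isEig (Φ 0)
      exact ⟨fun _ => a, fun _ => b, continuousOn_const, continuousOn_const,
        fun x _ => by simpa using h⟩
    | succ k ih =>
      intro hk
      obtain ⟨φ₁, φ₂, hc₁, hc₂, h⟩ := ih (by omega)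
      set Ψ : E → ℝ × ℂ := fun x => Φ ((((k + 1 : ℕ) : ℝ) / n) • x) with hΨ
      have hΨc : ContinuousOn Ψ (Metric.closedBall 0 R) :=
        hc.comp (by fun_prop) (fun x hx => hmem _ hk x hx)
      have hN : ContinuousOn (fun x => (euclNorm (Ψ x) : ℂ)) (Metric.closedBall 0 R) :=
        (Complex.continuous_ofReal.comp continuous_euclNorm).comp_continuousOn hΨc
      have ht : ContinuousOn (fun x => ((Ψ x).1 : ℂ)) (Metric.closedBall 0 R) :=
        (Complex.continuous_ofReal.comp continuous_fst).comp_continuousOn hΨc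
      have hz : ContinuousOn (fun x => (Ψ x).2) (Metric.closedBall 0 R) :=
        continuous_snd.comp_continuousOn hΨc
      have hzb : ContinuousOn (fun x => starRingEnd ℂ (Ψ x).2) (Metric.closedBall 0 R) :=
        Complex.continuous_conj.comp_continuousOn hz
      refine ⟨fun x => (euclNorm (Ψ x) + (Ψ x).1) * φ₁ x + (Ψ x).2 * φ₂ x,
        fun x => starRingEnd ℂ (Ψ x).2 * φ₁ x + (euclNorm (Ψ x) - (Ψ x).1) * φ₂ x,
        ((hN.add ht).mul hc₁).add (hz.mul hc₂), (hzb.mul hc₁).add ((hN.sub ht).mul hc₂), ?_⟩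
      intro x hx
      refine (h x hx).1.step (h x hx).2 ?_
      have hd := huc _ (hmem k (by omega) x hx) _ (hmem (k + 1) hk x hx) (by
        rw [dist_eq_norm, ← sub_smul, norm_smul]
        have : (k : ℝ) / n - ((k + 1 : ℕ) : ℝ) / n = -(1 / n) := by push_cast; ring
        rw [this, norm_neg, Real.norm_of_nonneg (by positivity)]
        rw [mem_closedBall_zero_iff] at hx
        calc 1 / (n : ℝ) * ‖x‖ ≤ 1 / n * R := by gcongr
          _ = R / n := by ring
          _ < η := hRn)
      rw [dist_eq_norm] at hd
      have h1 : δ ≤ ‖Φ (((k : ℝ) / n) • x)‖ := hmin (hmem k (by omega) x hx)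
      have h2 := norm_le_euclNorm (Φ (((k : ℝ) / n) • x))
      have h3 := euclNorm_sq_le (Φ (((k : ℝ) / n) • x) - Ψ x)
      refine lt_of_lt_of_le ?_ (h1.trans h2)
      refine lt_of_pow_lt_pow_left₀ 2 hδ0.le (h3.trans_lt ?_)
      have h4 : ‖Φ (((k : ℝ) / n) • x) - Ψ x‖ ^ 2 ≤ (δ / 2) ^ 2 :=
        pow_le_pow_left₀ (norm_nonneg _) hd.le 2
      nlinarith
  obtain ⟨φ₁, φ₂, h1, h2, h⟩ := key n le_rfl
  refine ⟨φ₁, φ₂, h1, h2, fun x hx => ?_⟩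
  simpa [div_self hn0.ne'] using h x hx

lemma continuous_extend_chart {S Y : Type*} [TopologicalSpace S] [T2Space S] [TopologicalSpace Y]
    (e : OpenPartialHomeomorph S ℂ) [∀ x, Decidable (x ∈ e.source)] {c : ℂ} {r : ℝ}
    (hball : Metric.closedBall c r ⊆ e.target) {k : ℂ → Y} {y : Y} (hk : Continuous k)
    (hky : ∀ z ∉ Metric.closedBall c r, k z = y) :
    Continuous fun x => if x ∈ e.source then k (e x) else y := by
  rw [continuous_iff_continuousAt]
  intro x
  by_cases hxs : x ∈ e.source
  · refine (hk.continuousAt.comp (e.continuousAt hxs)).congr ?_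
    filter_upwards [e.open_source.mem_nhds hxs] with z hz
    simp [hz]
  · have hcomp : IsCompact (e.symm '' Metric.closedBall c r) :=
      (isCompact_closedBall c r).image_of_continuousOn (e.symm.continuousOn.mono hball)
    have hx : x ∉ e.symm '' Metric.closedBall c r := by
      rintro ⟨z, hz, rfl⟩
      exact hxs (e.map_target (hball hz))
    refine continuousAt_const.congr (f := fun _ => y) ?_
    filter_upwards [hcomp.isClosed.isOpen_compl.mem_nhds hx] with z hz
    split_ifs with hzs
    · exact (hky _ fun h => hz ⟨_, h, e.left_inv hzs⟩).symm
    · rfl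

/-- A closed surface carries a nowhere zero map to `ℝ × ℂ` without eigenvector field. -/
lemma exists_not_spinor {S : Type*} [TopologicalSpace S] [T2Space S] [CompactSpace S] [Nonempty S]
    (hS : ∀ x : S, ∃ e : OpenPartialHomeomorph S ℂ, x ∈ e.source) :
    ∃ g : S → ℝ × ℂ, Continuous g ∧ (∀ x, g x ≠ 0) ∧ ∀ φ₁ φ₂ : S → ℂ, Continuous φ₁ →
      Continuous φ₂ → (∀ x, IsEig (g x) (φ₁ x) (φ₂ x)) → ¬ ∀ x, φ₁ x ≠ 0 ∨ φ₂ x ≠ 0 := by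
  classical
  obtain ⟨p⟩ := ‹Nonempty S›
  obtain ⟨e, hp⟩ := hS p
  obtain ⟨r, hr, hb⟩ := Metric.nhds_basis_closedBall.mem_iff.1
    (e.open_target.mem_nhds (e.map_source hp))
  set k : ℂ → ℝ × ℂ := fun z => (2 * min (‖z - e p‖ / r) 1 - 1,
    (max 0 (1 - ‖z - e p‖ / r) : ℝ) * (z - e p)) with hk
  have hkc : Continuous k := by
    refine Continuous.prodMk (by fun_prop) (Continuous.mul (Complex.continuous_ofReal.comp ?_) ?_)
    · fun_prop
    · fun_prop
  have hin : ∀ z, ‖z - e p‖ < r → k z = (2 * (‖z - e p‖ / r) - 1,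
      ((1 - ‖z - e p‖ / r : ℝ) : ℂ) * (z - e p)) := by
    intro z hz
    have : ‖z - e p‖ / r < 1 := (div_lt_one hr).2 hz
    simp only [hk, min_eq_left this.le, max_eq_right (show 0 ≤ 1 - ‖z - e p‖ / r by linarith)]
  have hout : ∀ z, r ≤ ‖z - e p‖ → k z = (1, 0) := by
    intro z hz
    have : 1 ≤ ‖z - e p‖ / r := (one_le_div hr).2 hz
    simp only [hk, min_eq_right this, max_eq_left (show 1 - ‖z - e p‖ / r ≤ 0 by linarith)]
    norm_num
  have hkz : ∀ z, (k z).2 = 0 → (k z).1 ≤ 0 → z = e p := by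
    intro z h1 h2
    rcases lt_or_ge ‖z - e p‖ r with h | h
    · have h3 : ‖z - e p‖ / r < 1 := (div_lt_one hr).2 h
      rw [hin z h] at h1
      rcases mul_eq_zero.1 h1 with h4 | h4
      · have : 1 - ‖z - e p‖ / r = 0 := by exact_mod_cast h4
        linarith
      · exact sub_eq_zero.1 h4
    · rw [hout z h] at h2
      norm_num at h2
  have hkp : k (e p) = (-1, 0) := by
    rw [hin _ (by simpa using hr)]
    simp
  set g : S → ℝ × ℂ := fun x => if x ∈ e.source then k (e x) else (1, 0) with hg
  have hgz : ∀ x, (g x).2 = 0 → (g x).1 ≤ 0 → x = p := by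
    intro x h1 h2
    simp only [hg] at h1 h2
    split_ifs at h1 h2 with hx
    · exact e.injOn hx hp (hkz _ h1 h2)
    · norm_num at h2
  have hgp : g p = (-1, 0) := by simp only [hg, if_pos hp, hkp]
  refine ⟨g, ?_, ?_, ?_⟩
  · refine continuous_extend_chart e hb hkc fun z hz => hout z ?_
    rw [Metric.mem_closedBall, dist_eq_norm] at hz
    exact (not_le.1 hz).le
  · intro x hx
    have := hgz x (by simp [hx]) (by simp [hx])
    rw [this, hgp] at hx
    simpa using congrArg Prod.fst hx
  · intro φ₁ φ₂ hc₁ hc₂ heig hne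
    have hzero : ∀ x, φ₁ x = 0 → x = p := by
      intro x hx
      have h2 : φ₂ x ≠ 0 := (hne x).resolve_left fun h => h hx
      have h3 := (heig x).2
      rw [hx, mul_zero, eq_comm, mul_eq_zero] at h3
      have h4 : euclNorm (g x) + (g x).1 = 0 := by exact_mod_cast h3.resolve_right h2
      have h5 := euclNorm_nonneg (g x)
      have h6 := euclNorm_sq (g x)
      refine hgz x ?_ (by linarith)
      rw [← Complex.normSq_eq_zero]
      nlinarith
    have hNp : euclNorm (g p) = 1 := by
      rw [hgp, euclNorm]
      simp
    have hφp : φ₁ p = 0 := by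
      have h3 := (heig p).1
      rw [hNp, hgp] at h3
      simp only [zero_mul] at h3
      push_cast at h3
      linear_combination -h3 / 2
    have hφ2 : φ₂ p ≠ 0 := (hne p).resolve_left fun h => h hφp
    have hcont : ∀ x ∉ ({p} : Set S), ContinuousAt (fun x => dir (φ₁ x)) x := fun x hx =>
      ContinuousAt.comp (g := dir) (continuousAt_dir fun h => hx (hzero x h)) hc₁.continuousAt
    have heven := even_ncard_not_isSqAt hS (finite_singleton p) hcont
    have hset : {x | ¬ IsSqAt (fun x => dir (φ₁ x)) x} = {p} := by
      ext x
      rw [mem_singleton_iff, Set.mem_ofPred_eq]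
      constructor
      · intro hx
        by_contra hxp
        refine hx (isSqAt_of_continuousAt ?_)
        filter_upwards [isOpen_ne.mem_nhds hxp] with y hy using hcont y hy
      · rintro rfl hsq
        have hsq2 : IsSqAt (fun y => dir (φ₂ y)) x := by
          refine isSqAt_of_continuousAt ?_
          filter_upwards [hc₂.continuousAt.eventually_ne hφ2] with y hy
          exact ContinuousAt.comp (g := dir) (continuousAt_dir hy) hc₂.continuousAt
        have hsq3 : IsSqAt (fun y => dir (e y - e x) ^ (1 : ℤ)) x := by
          refine (hsq.mul hsq2.inv).congr ?_
          have hnear : ∀ᶠ y in 𝓝 x, e y ∈ Metric.ball (e x) r :=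
            (e.continuousAt hp).eventually_mem (Metric.ball_mem_nhds _ hr)
          filter_upwards [nhdsWithin_le_nhds hnear, self_mem_nhdsWithin,
            nhdsWithin_le_nhds (hc₂.continuousAt.eventually_ne hφ2),
            nhdsWithin_le_nhds (e.open_source.mem_nhds hp)] with y hy hyx hy2 hys
          rw [Metric.mem_ball, dist_eq_norm] at hy
          have hlt : ‖e y - e x‖ / r < 1 := (div_lt_one hr).2 hy
          have hey : e y - e x ≠ 0 := fun h => hyx (e.injOn hys hp (sub_eq_zero.1 h))
          have h3 := (heig y).1
          have hgy : g y = k (e y) := by simp only [hg, if_pos hys]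
          have hNt : 0 < euclNorm (g y) - (g y).1 := by
            have hz : (g y).2 ≠ 0 := by
              rw [hgy, hin _ hy]
              refine mul_ne_zero ?_ hey
              exact_mod_cast (show (0 : ℝ) < 1 - ‖e y - e x‖ / r by linarith).ne'
            have h5 := euclNorm_nonneg (g y)
            have h6 := euclNorm_sq (g y)
            have h7 := Complex.normSq_pos.2 hz
            nlinarith
          have hdir : dir (φ₁ y) = dir (e y - e x) * dir (φ₂ y) := by
            rw [← dir_mul hey hy2]
            refine dir_eq_of_eq_mul (r := (1 - ‖e y - e x‖ / r) / (euclNorm (g y) - (g y).1) *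
              ‖(e y - e x) * φ₂ y‖) ?_ ?_
            · have : 0 < 1 - ‖e y - e x‖ / r := by linarith
              have : 0 < ‖(e y - e x) * φ₂ y‖ := norm_pos_iff.2 (mul_ne_zero hey hy2)
              positivity
            · rw [Complex.ofReal_mul, mul_assoc, norm_mul_dir]
              have h8 : (g y).2 = ((1 - ‖e y - e x‖ / r : ℝ) : ℂ) * (e y - e x) := by
                rw [hgy, hin _ hy]
              rw [h8] at h3
              have hNt' : ((euclNorm (g y) - (g y).1 : ℝ) : ℂ) ≠ 0 := by exact_mod_cast hNt.ne'
              rw [Complex.ofReal_div, div_mul_eq_mul_div, eq_div_iff hNt', Complex.ofReal_sub]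
              linear_combination -h3
          rw [Pi.mul_apply, Pi.inv_apply, hdir, mul_inv_cancel_right, zpow_one]
        rw [← isSqAt_comp_symm_iff e hp] at hsq3
        have hsq4 : IsSqAt (fun z => dir (z - e x) ^ (1 : ℤ)) (e x) := by
          refine hsq3.congr ?_
          filter_upwards [nhdsWithin_le_nhds (e.open_target.mem_nhds (e.map_source hp))] with z hz
          rw [e.right_inv hz]
        exact absurd (isSqAt_dir_zpow.1 hsq4) (by decide)
    rw [hset, ncard_singleton] at heven
    exact absurd heven (by decide)

end Spinor

section Poles

variable {E : Type*} [NormedAddCommGroup E] [NormedSpace ℝ E]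

/-- The restriction of `G` to `X` extends to a map which is continuous and nonzero off `F`. -/
def ExtendsOff (X : Set E) (G : E → ℝ × ℂ) (F : Set E) : Prop :=
  ∃ Φ : E → ℝ × ℂ, (∀ x ∉ F, ContinuousAt Φ x ∧ Φ x ≠ 0) ∧ ∀ x ∈ X, Φ x = G x

lemma exists_extendsOff [FiniteDimensional ℝ E] (hE : Module.finrank ℝ E = 3) {X : Set E}
    (hX : IsCompact X) {G : E → ℝ × ℂ} (hG : Continuous G) (h0 : ∀ x ∈ X, G x ≠ 0) :
    ∃ F : Set E, F.Finite ∧ F ⊆ Xᶜ ∧ ExtendsOff X G F := by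
  have : ProperSpace E := FiniteDimensional.proper ℝ E
  obtain ⟨R, hR⟩ := hX.isBounded.exists_norm_le
  set χ : E → ℝ := fun x => max 0 (min 1 (R + 1 - ‖x‖)) with hχ
  have hχc : Continuous χ := by fun_prop
  set G' : E → ℝ × ℂ := fun x => χ x • G x + (1 - χ x) • ((1, 0) : ℝ × ℂ) with hG'
  have hG'c : Continuous G' := by fun_prop
  have hG'X : ∀ x ∈ X, G' x = G x := by
    intro x hx
    have : χ x = 1 := by
      have := hR x hx
      simp only [hχ]
      rw [min_eq_left (by linarith)]
      norm_num
    simp [hG', this]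
  set K : Set E := Metric.closedBall 0 (R + 1) ∩ G' ⁻¹' {0} with hK
  have hKc : IsCompact K :=
    (isCompact_closedBall _ _).inter_right (isClosed_singleton.preimage hG'c)
  have hKX : K ⊆ Xᶜ := by
    rintro x ⟨-, hx⟩ hxX
    exact h0 x hxX ((hG'X x hxX).symm.trans hx)
  have hV : Module.finrank ℝ (ℝ × ℂ) = Module.finrank ℝ E := by
    rw [hE, Module.finrank_prod, Complex.finrank_real_complex, Module.finrank_self]
  obtain ⟨ψ, K', hK', hK'X, hψc, hψ, hfin⟩ := exists_perturbation_finite_zeros hV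
    hX.isClosed.isOpen_compl hKc hKX hG'c.continuousOn (fun x _ hx0 => by
      refine ⟨?_, hx0⟩
      by_contra hx
      rw [mem_closedBall_zero_iff, not_le] at hx
      have : χ x = 0 := by
        simp only [hχ]
        exact max_eq_left ((min_le_right _ _).trans (by linarith))
      simp [hG', this] at hx0)
  have hψX : ∀ x ∈ X, ψ x = G x := fun x hx => by
    rw [hψ x fun h => hK'X h hx, hG'X x hx]
  refine ⟨_, hfin, fun x hx => hx.1, ψ, fun x hx => ⟨?_, ?_⟩, hψX⟩
  · by_cases hxX : x ∈ X
    · refine hG'c.continuousAt.congr ?_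
      filter_upwards [hK'.isClosed.isOpen_compl.mem_nhds fun h => hK'X h hxX] with y hy
      exact (hψ y hy).symm
    · exact hψc.continuousAt (hX.isClosed.isOpen_compl.mem_nhds hxX)
  · intro hx0
    by_cases hxX : x ∈ X
    · exact h0 x hxX ((hψX x hxX).symm.trans hx0)
    · exact hx ⟨hxX, hx0⟩

/-- Poles can be moved slightly. -/
lemma ExtendsOff.move {X : Set E} (hX : IsClosed X) {G : E → ℝ × ℂ} {F : Set E} (hF : F.Finite)
    {a : E} (ha : a ∉ X) : ∃ ε > 0, ∀ b ∈ Metric.ball a ε, ∀ b' ∈ Metric.ball a ε,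
      ExtendsOff X G (insert b F) → ExtendsOff X G (insert b' F) := by
  obtain ⟨η, hη, hη2⟩ := Metric.isOpen_iff.1 hX.isOpen_compl a ha
  refine ⟨η / 4, by linarith, fun b hb b' hb' => ?_⟩
  rintro ⟨Φ, hΦ, hΦX⟩
  rw [Metric.mem_ball, dist_eq_norm] at hb hb'
  obtain ⟨r, hr, hrF⟩ := ((Ioo_infinite (show 2 * (η / 4) < 3 * (η / 4) by linarith)).sdiff
    (hF.image fun q => ‖q - b'‖)).nonempty
  have hr0 : 0 < r := by linarith [hr.1]
  set m : E → E := fun x => b' + (max 1 (r / ‖x - b'‖)) • (x - b') with hm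
  have hmc : ∀ x, x ≠ b' → ContinuousAt m x := by
    intro x hx
    have : ‖x - b'‖ ≠ 0 := norm_ne_zero_iff.2 (sub_ne_zero.2 hx)
    refine continuousAt_const.add (ContinuousAt.smul ?_ (by fun_prop))
    exact continuousAt_const.max (continuousAt_const.div (by fun_prop) this)
  have hmid : ∀ x, r < ‖x - b'‖ → m x = x := by
    intro x hx
    have : r / ‖x - b'‖ ≤ 1 := (div_le_one (hr0.trans hx)).2 hx.le
    simp [hm, max_eq_left this]
  have hmr : ∀ x, x ≠ b' → ‖x - b'‖ ≤ r → ‖m x - b'‖ = r := by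
    intro x hx hxr
    have h1 : 0 < ‖x - b'‖ := norm_pos_iff.2 (sub_ne_zero.2 hx)
    have : 1 ≤ r / ‖x - b'‖ := (one_le_div h1).2 hxr
    simp only [hm, max_eq_right this, add_sub_cancel_left, norm_smul]
    rw [Real.norm_of_nonneg (by positivity), div_mul_cancel₀ _ h1.ne']
  have hbb : ‖b - b'‖ < r := by
    have : b - b' = (b - a) - (b' - a) := by abel
    rw [this]
    have := norm_sub_le (b - a) (b' - a)
    linarith [hr.1]
  have hmF : ∀ x ∉ insert b' F, m x ∉ insert b F := by
    intro x hx
    rw [mem_insert_iff, not_or] at hx ⊢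
    rcases lt_or_ge r ‖x - b'‖ with h | h
    · rw [hmid x h]
      refine ⟨?_, hx.2⟩
      rintro rfl
      exact hbb.not_gt h
    · have h2 := hmr x hx.1 h
      refine ⟨fun h3 => ?_, fun h3 => hrF ⟨_, h3, h2⟩⟩
      rw [h3] at h2
      exact hbb.ne h2
  refine ⟨fun x => Φ (m x), fun x hx => ⟨?_, (hΦ _ (hmF x hx)).2⟩, fun x hx => ?_⟩
  · exact ContinuousAt.comp (hΦ _ (hmF x hx)).1 (hmc x fun h => hx (Or.inl h))
  · suffices hlt : r < ‖x - b'‖ from (congrArg Φ (hmid x hlt)).trans (hΦX x hx)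
    by_contra! hle
    refine hη2 ?_ hx
    rw [Metric.mem_ball, dist_eq_norm]
    have : x - a = (x - b') + (b' - a) := by abel
    rw [this]
    have := norm_add_le (x - b') (b' - a)
    linarith [hr.2]

lemma ExtendsOff.push {X : Set E} (hX : IsClosed X)
    (hU : ∀ T ⊆ Xᶜ, IsOpen T → IsOpen (Xᶜ \ T) → T.Nonempty → ∀ R : ℝ, ∃ c ∈ T, R < ‖c‖)
    {G : E → ℝ × ℂ} {F : Set E} (hF : F.Finite) {a : E} (ha : a ∉ X)
    (h : ExtendsOff X G (insert a F)) (R : ℝ) :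
    ∃ c : E, R < ‖c‖ ∧ ExtendsOff X G (insert c F) := by
  set T : Set E := {b | b ∈ Xᶜ ∧ ExtendsOff X G (insert b F)} with hT
  have hT1 : IsOpen T := by
    rw [isOpen_iff_mem_nhds]
    rintro b ⟨hb, hbE⟩
    obtain ⟨ε, hε, hmove⟩ := ExtendsOff.move (G := G) hX hF hb
    filter_upwards [hX.isOpen_compl.mem_nhds hb, Metric.ball_mem_nhds b hε] with y hy hyb
    exact ⟨hy, hmove b (Metric.mem_ball_self hε) y hyb hbE⟩
  have hT2 : IsOpen (Xᶜ \ T) := by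
    rw [isOpen_iff_mem_nhds]
    rintro b ⟨hb, hbE⟩
    obtain ⟨ε, hε, hmove⟩ := ExtendsOff.move (G := G) hX hF hb
    filter_upwards [hX.isOpen_compl.mem_nhds hb, Metric.ball_mem_nhds b hε] with y hy hyb
    exact ⟨hy, fun h => hbE ⟨hb, hmove y hyb b (Metric.mem_ball_self hε) h.2⟩⟩
  obtain ⟨c, hc, hcR⟩ := hU T (fun b hb => hb.1) hT1 hT2 ⟨a, ha, h⟩ R
  exact ⟨c, hcR, hc.2⟩

lemma ExtendsOff.push_all {X : Set E} (hX : IsClosed X)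
    (hU : ∀ T ⊆ Xᶜ, IsOpen T → IsOpen (Xᶜ \ T) → T.Nonempty → ∀ R : ℝ, ∃ c ∈ T, R < ‖c‖)
    {G : E → ℝ × ℂ} (R : ℝ) {F : Set E} (hF : F.Finite) : F ⊆ Xᶜ → ∀ F' : Set E, F'.Finite →
      (∀ x ∈ F', R < ‖x‖) → ExtendsOff X G (F ∪ F') →
      ∃ F'' : Set E, (∀ x ∈ F'', R < ‖x‖) ∧ ExtendsOff X G F'' := by
  induction F, hF using Set.Finite.induction_on with
  | empty =>
    intro _ F' _ hF'R h
    exact ⟨F', hF'R, by simpa using h⟩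
  | @insert a s _ hs ih =>
    intro hsub F' hF' hF'R h
    rw [insert_union] at h
    obtain ⟨c, hc, h2⟩ := ExtendsOff.push hX hU (hs.union hF') (hsub (mem_insert a s)) h R
    refine ih ((subset_insert a s).trans hsub) (insert c F') (hF'.insert c) ?_ ?_
    · rintro x (rfl | hx)
      · exact hc
      · exact hF'R x hx
    · rwa [union_insert]

/-- The complement of a closed surface in three-space has a bounded clopen part. -/
theorem exists_bounded_clopen [FiniteDimensional ℝ E] (hE : Module.finrank ℝ E = 3)
    {S : Type*} [TopologicalSpace S] [T2Space S] [CompactSpace S] [Nonempty S]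
    (hS : ∀ x : S, ∃ e : OpenPartialHomeomorph S ℂ, x ∈ e.source) {j : S → E}
    (hj : IsEmbedding j) :
    ∃ T ⊆ (range j)ᶜ, IsOpen T ∧ IsOpen ((range j)ᶜ \ T) ∧ T.Nonempty ∧
      ∃ R : ℝ, ∀ c ∈ T, ‖c‖ ≤ R := by
  by_contra! hU
  have : ProperSpace E := FiniteDimensional.proper ℝ E
  obtain ⟨g, hg, hg0, hspin⟩ := exists_not_spinor hS
  have hX : IsCompact (range j) := isCompact_range hj.continuous
  have hjc : IsClosedEmbedding j := ⟨hj, hX.isClosed⟩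
  obtain ⟨G, hG⟩ := ContinuousMap.exists_extension hjc ⟨g, hg⟩
  have hGj : ∀ x, G (j x) = g x := fun x => DFunLike.congr_fun hG x
  obtain ⟨R, hR⟩ := hX.isBounded.exists_pos_norm_le
  obtain ⟨F, hF, hFX, hext⟩ := exists_extendsOff hE hX G.continuous (by
    rintro _ ⟨x, rfl⟩
    rw [hGj]
    exact hg0 x)
  obtain ⟨F', hF'R, Φ, hΦ, hΦX⟩ := ExtendsOff.push_all (F' := ∅) hX.isClosed
    (fun T hT h1 h2 h3 => hU T hT h1 h2 h3) R hF hFX finite_empty (by simp) (by simpa using hext)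
  have hball : ∀ x ∈ Metric.closedBall (0 : E) R, x ∉ F' := fun x hx hxF => by
    rw [mem_closedBall_zero_iff] at hx
    exact hx.not_gt (hF'R x hxF)
  obtain ⟨φ₁, φ₂, hc₁, hc₂, h⟩ := exists_spinor hR.1
    (fun x hx => (hΦ x (hball x hx)).1.continuousWithinAt) (fun x hx => (hΦ x (hball x hx)).2)
  have hjR : ∀ x, j x ∈ Metric.closedBall (0 : E) R := fun x =>
    mem_closedBall_zero_iff.2 (hR.2 _ (mem_range_self x))
  refine hspin (fun x => φ₁ (j x)) (fun x => φ₂ (j x))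
    (hc₁.comp_continuous hj.continuous hjR) (hc₂.comp_continuous hj.continuous hjR)
    (fun x => ?_) (fun x => (h _ (hjR x)).2)
  rw [← hGj, ← hΦX _ (mem_range_self x)]
  exact (h _ (hjR x)).1

end Poles

section Dimension

variable {E : Type*} [NormedAddCommGroup E] [NormedSpace ℝ E]

lemma starConvex_compl_ray {u : E} (hu : u ≠ 0) :
    StarConvex ℝ (-u) ((fun t : ℝ => t • u) '' Ici 0)ᶜ := by
  intro x hx a b ha hb hab
  rintro ⟨t, ht, htx⟩
  have ht0 : 0 ≤ t := ht
  have htx' : t • u = a • -u + b • x := htx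
  have h1 : b • x = (t + a) • u := by
    rw [add_smul, htx', smul_neg]
    abel
  rcases hb.eq_or_lt with rfl | hb
  · rw [zero_smul, eq_comm, smul_eq_zero] at h1
    rcases h1 with h1 | h1
    · linarith
    · exact hu h1
  · refine hx ⟨b⁻¹ * (t + a), mul_nonneg (inv_nonneg.2 hb.le) (add_nonneg ht0 ha), ?_⟩
    change (b⁻¹ * (t + a)) • u = x
    rw [mul_smul, ← h1, smul_smul, inv_mul_cancel₀ hb.ne', one_smul]

lemma exists_sqrt_of_starConvex {A : Set E} (hA : IsOpen A) {c : E} (hc : c ∈ A)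
    (hst : StarConvex ℝ c A) {φ : E → Circle} (hφ : ContinuousOn φ A) :
    ∃ ψ : E → Circle, ContinuousOn ψ A ∧ ∀ x ∈ A, ψ x ^ 2 = φ x := by
  classical
  have : ContractibleSpace A := hst.contractibleSpace ⟨c, hc⟩
  have : LocallyPathConnectedSpace A := hA.locallyPathConnectedSpace
  obtain ⟨L, hL, hLφ⟩ := exists_lift (fun x : A => φ x) (continuousOn_iff_continuous_domRestrict.1 hφ)
    ⟨c, hc⟩
  refine ⟨fun x => if h : x ∈ A then Circle.exp (L ⟨x, h⟩ / 2) else 1, ?_, fun x hx => ?_⟩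
  · rw [continuousOn_iff_continuous_domRestrict]
    refine (Circle.exp.continuous.comp (hL.div_const 2)).congr fun x => ?_
    simp
  · simp only [dif_pos hx]
    rw [pow_two, ← Circle.exp_add, add_halves, hLφ]

/-- In dimension three a circle-valued function has no isolated essential singularities. -/
lemma isSqAt_of_finrank_eq_three (hE : Module.finrank ℝ E = 3) {φ : E → Circle}
    (hφ : ∀ x ≠ 0, ContinuousAt φ x) : IsSqAt φ 0 := by
  classical
  have : FiniteDimensional ℝ E := Module.finite_of_finrank_eq_succ hE
  have : Nontrivial E := Module.nontrivial_of_finrank_eq_succ hE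
  obtain ⟨u, hu⟩ := exists_ne (0 : E)
  set A : E → Set E := fun u => ((fun t : ℝ => t • u) '' Ici 0)ᶜ with hA
  have hAo : ∀ u, IsOpen (A u) := fun u =>
    (isClosedMap_smul_left u _ isClosed_Ici).isOpen_compl
  have h0 : ∀ u, ∀ x ∈ A u, x ≠ 0 := by
    rintro u x hx rfl
    exact hx ⟨0, self_mem_Ici, by simp⟩
  have hAu : ∀ u ≠ 0, -u ∈ A u := by
    rintro u hu ⟨t, ht, h⟩
    have ht0 : 0 ≤ t := ht
    have h' : (t + 1) • u = 0 := by
      rw [add_smul, one_smul]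
      exact add_eq_zero_iff_eq_neg.2 h
    rcases smul_eq_zero.1 h' with h' | h'
    · linarith
    · exact hu h'
  have hsq : ∀ u ≠ 0, ∃ ψ : E → Circle, ContinuousOn ψ (A u) ∧ ∀ x ∈ A u, ψ x ^ 2 = φ x :=
    fun u hu => exists_sqrt_of_starConvex (hAo u) (hAu u hu) (starConvex_compl_ray hu)
      fun x hx => (hφ x (h0 u x hx)).continuousWithinAt
  obtain ⟨ψ, hψ, hψ2⟩ := hsq u hu
  obtain ⟨χ, hχ, hχ2⟩ := hsq (-u) (neg_ne_zero.2 hu)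
  have hinter : A u ∩ A (-u) = ((Submodule.span ℝ {u} : Submodule ℝ E) : Set E)ᶜ := by
    ext x
    simp only [hA, mem_inter_iff, mem_compl_iff, SetLike.mem_coe, Submodule.mem_span_singleton,
      mem_image, mem_Ici]
    constructor
    · rintro ⟨h1, h2⟩ ⟨t, rfl⟩
      rcases le_total 0 t with ht | ht
      · exact h1 ⟨t, ht, rfl⟩
      · exact h2 ⟨-t, by linarith, by simp⟩
    · rintro h
      refine ⟨fun ⟨t, _, ht⟩ => h ⟨t, ht⟩, fun ⟨t, _, ht⟩ => h ⟨-t, ?_⟩⟩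
      rw [← ht]
      simp
  have hunion : ∀ x ≠ 0, x ∉ A u → x ∈ A (-u) := by
    rintro x hx hxu ⟨s, hs, hsx⟩
    obtain ⟨t, ht, rfl⟩ := not_not.1 hxu
    have hs0 : 0 ≤ s := hs
    have ht0 : 0 ≤ t := ht
    have hsx' : s • -u = t • u := hsx
    have h1 : (t + s) • u = 0 := by rw [add_smul, ← hsx', smul_neg]; simp
    rcases smul_eq_zero.1 h1 with h1 | h1
    · have : t = 0 := by linarith
      exact hx (by simp [this])
    · exact hu h1
  have hconn : IsPreconnected (A u ∩ A (-u)) := by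
    rw [hinter]
    refine (isConnected_compl_of_one_lt_codim ?_).isPreconnected
    apply Module.lt_rank_of_lt_finrank
    have h1 := Submodule.finrank_quotient_add_finrank (Submodule.span ℝ {u})
    rw [finrank_span_singleton hu, hE] at h1
    omega
  obtain ⟨ε, hε, hεψ⟩ : ∃ ε : Circle, ε ^ 2 = 1 ∧ ∀ x ∈ A u ∩ A (-u), ψ x = ε * χ x := by
    have := hconn.eq_or_eq_neg_of_sq_eq (f := fun x => (ψ x : ℂ)) (g := fun x => (χ x : ℂ))
      (continuous_circle_coe.comp_continuousOn (hψ.mono inter_subset_left))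
      (continuous_circle_coe.comp_continuousOn (hχ.mono inter_subset_right))
      (fun x hx => by
        have := congrArg (fun z : Circle => (z : ℂ)) ((hψ2 x hx.1).trans (hχ2 x hx.2).symm)
        simpa using this) (fun _ => Circle.coe_ne_zero _)
    rcases this with h | h
    · exact ⟨1, one_pow 2, fun x hx => Circle.coe_injective (by simpa using h hx)⟩
    · refine ⟨Circle.exp Real.pi, ?_, fun x hx => Circle.coe_injective ?_⟩
      · rw [pow_two, ← Circle.exp_add, ← two_mul, Circle.exp_two_pi]
      · rw [Circle.coe_mul, Circle.coe_exp, Complex.exp_pi_mul_I]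
        simpa using h hx
  refine ⟨fun x => if x ∈ A u then ψ x else ε * χ x, ?_⟩
  filter_upwards [self_mem_nhdsWithin] with x hx
  by_cases hxu : x ∈ A u
  · refine ⟨(hψ.continuousAt ((hAo u).mem_nhds hxu)).congr ?_, by simp [hxu, hψ2 x hxu]⟩
    filter_upwards [(hAo u).mem_nhds hxu] with y hy
    simp [hy]
  · have hxu' := hunion x hx hxu
    refine ⟨(continuousAt_const.mul (hχ.continuousAt ((hAo (-u)).mem_nhds hxu'))).congr
      (f := fun y => ε * χ y) ?_, by simp [hxu, mul_pow, hε, hχ2 x hxu']⟩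
    filter_upwards [(hAo (-u)).mem_nhds hxu'] with y hy
    split_ifs with hyu
    · exact (hεψ y ⟨hyu, hy⟩).symm
    · rfl

lemma source_eq_empty_of_finrank_eq_three {E : Type*} [NormedAddCommGroup E]
    [InnerProductSpace ℝ E] (hE : Module.finrank ℝ E = 3) (k : OpenPartialHomeomorph E ℂ) :
    k.source = ∅ := by
  by_contra hne
  obtain ⟨a, ha⟩ := nonempty_iff_ne_empty.2 hne
  obtain ⟨ε, hε, hb⟩ := Metric.isOpen_iff.1 k.open_source a ha
  set l : OpenPartialHomeomorph E ℂ := (OpenPartialHomeomorph.univBall a ε).trans k with hl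
  have hls : l.source = univ := by
    rw [hl, OpenPartialHomeomorph.trans_source, OpenPartialHomeomorph.univBall_source, univ_inter,
      eq_univ_iff_forall]
    intro x
    apply hb
    rw [← OpenPartialHomeomorph.univBall_target a hε]
    exact OpenPartialHomeomorph.map_source _ (by simp)
  have hls' : ∀ x, x ∈ l.source := fun x => hls ▸ mem_univ x
  have hsq : IsSqAt (fun x => dir (l x - l 0) ^ (1 : ℤ)) 0 := by
    refine isSqAt_of_finrank_eq_three hE fun x hx => ?_
    have hne : l x ≠ l 0 := fun h => hx (l.injOn (hls' x) (hls' 0) h)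
    simp only [zpow_one]
    exact ContinuousAt.comp (f := l) (dir_sub_continuousAt hne) (l.continuousAt (hls' x))
  rw [← isSqAt_comp_symm_iff l (hls' 0)] at hsq
  have hsq2 : IsSqAt (fun z => dir (z - l 0) ^ (1 : ℤ)) (l 0) := by
    refine hsq.congr ?_
    filter_upwards [nhdsWithin_le_nhds (l.open_target.mem_nhds (l.map_source (hls' 0)))] with z hz
    rw [l.right_inv hz]
  exact absurd (isSqAt_dir_zpow.1 hsq2) (by decide)

end Dimension

lemma exists_chart_complex {S : Type*} [TopologicalSpace S]
    [ChartedSpace (EuclideanSpace ℝ (Fin 2)) S] (x : S) :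
    ∃ e : OpenPartialHomeomorph S ℂ, x ∈ e.source :=
  ⟨(chartAt (EuclideanSpace ℝ (Fin 2)) x).transHomeomorph
    Complex.orthonormalBasisOneI.repr.symm.toHomeomorph, mem_chart_source _ x⟩

section Sphere

variable {S : Type*} [TopologicalSpace S]

lemma finrank_orthogonal_eq_three {v : EuclideanSpace ℝ (Fin 4)} (hv : ‖v‖ = 1) :
    Module.finrank ℝ (ℝ ∙ v)ᗮ = 3 := by
  have : Fact (Module.finrank ℝ (EuclideanSpace ℝ (Fin 4)) = 3 + 1) := ⟨by simp⟩
  exact Submodule.finrank_orthogonal_span_singleton (norm_ne_zero_iff.1 (by simp [hv]))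

lemma range_ne_univ [Nonempty S] (hS : ∀ x : S, ∃ e : OpenPartialHomeomorph S ℂ, x ∈ e.source)
    {f : S → Metric.sphere (0 : EuclideanSpace ℝ (Fin 4)) 1} (hf : IsEmbedding f) :
    range f ≠ univ := by
  intro hsurj
  obtain ⟨p⟩ := ‹Nonempty S›
  obtain ⟨e, hp⟩ := hS p
  set h := hf.toHomeomorphOfSurjective (range_eq_univ.1 hsurj) with hh
  have hhp : h p = f p := rfl
  have hv : ‖((-f p : Metric.sphere (0 : EuclideanSpace ℝ (Fin 4)) 1) :
    EuclideanSpace ℝ (Fin 4))‖ = 1 := norm_eq_of_mem_sphere _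
  set σ := stereographic hv with hσ
  have hpσ : f p ∈ σ.source := by
    rw [hσ, stereographic_source, mem_compl_iff, mem_singleton_iff]
    intro h
    exact ne_neg_of_mem_unit_sphere ℝ (f p) (h.trans (Subtype.ext rfl))
  have hempty := source_eq_empty_of_finrank_eq_three (finrank_orthogonal_eq_three hv)
    ((σ.symm.trans h.symm.toOpenPartialHomeomorph).trans e)
  have hmem : σ (f p) ∈ ((σ.symm.trans h.symm.toOpenPartialHomeomorph).trans e).source := by
    have h1 : h.symm (f p) = p := by rw [← hhp, h.symm_apply_apply]
    rw [OpenPartialHomeomorph.trans_source, OpenPartialHomeomorph.trans_source]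
    refine ⟨⟨σ.map_source hpσ, trivial⟩, ?_⟩
    change h.symm (σ.symm (σ (f p))) ∈ e.source
    rwa [σ.left_inv hpσ, h1]
  rw [hempty] at hmem
  exact hmem

theorem not_isPreconnected_compl_range [T2Space S] [CompactSpace S] [Nonempty S]
    (hS : ∀ x : S, ∃ e : OpenPartialHomeomorph S ℂ, x ∈ e.source)
    {f : S → Metric.sphere (0 : EuclideanSpace ℝ (Fin 4)) 1} (hf : IsEmbedding f) :
    ¬ IsPreconnected (range f)ᶜ := by
  intro hconn
  obtain ⟨q, hq⟩ := (ne_univ_iff_exists_notMem _).1 (range_ne_univ hS hf)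
  have hv : ‖(q : EuclideanSpace ℝ (Fin 4))‖ = 1 := norm_eq_of_mem_sphere _
  set σ := stereographic hv with hσ
  have hsource : σ.source = {q}ᶜ := stereographic_source hv
  have htarget : ∀ y, y ∈ σ.target := fun y => by
    rw [hσ, stereographic_target]
    trivial
  have hfσ : ∀ x, f x ∈ σ.source := fun x => by
    rw [hsource]
    rintro rfl
    exact hq (mem_range_self x)
  have hjc : Continuous fun x => σ (f x) :=
    σ.continuousOn.comp_continuous hf.continuous hfσ
  have hj : IsEmbedding fun x => σ (f x) := (hjc.isClosedEmbedding fun x y hxy =>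
    hf.injective (σ.injOn (hfσ x) (hfσ y) hxy)).isEmbedding
  have hE := finrank_orthogonal_eq_three hv
  obtain ⟨T, hTX, hT, hT', ⟨t, ht⟩, R, hR⟩ := exists_bounded_clopen hE hS hj
  set X := range fun x => σ (f x) with hX
  have hXc : IsCompact X := isCompact_range hjc
  have hTXc : IsCompact (T ∪ X) := by
    refine Metric.isCompact_of_isClosed_isBounded ?_ ?_
    · have : T ∪ X = (Xᶜ \ T)ᶜ := by
        ext y
        simp only [mem_union, mem_compl_iff, Set.mem_sdiff]
        tauto
      rw [this]
      exact hT'.isClosed_compl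
    · exact (isBounded_iff_forall_norm_le.2 ⟨R, hR⟩).union hXc.isBounded
  have hσc : Continuous σ.symm := by
    have := σ.symm.continuousOn
    rw [σ.symm_source, hσ, stereographic_target] at this
    exact continuousOn_univ.1 this
  have hTo : IsOpen (σ.symm '' T) :=
    σ.symm.isOpen_image_of_subset_source hT fun y _ => htarget y
  have hVo : IsOpen (σ.symm '' (T ∪ X))ᶜ := (hTXc.image hσc).isClosed.isOpen_compl
  have hTf : ∀ y ∈ T, σ.symm y ∉ range f := by
    rintro y hy ⟨x, hx⟩
    exact hTX hy ⟨x, by simp only [hx, σ.right_inv (htarget y)]⟩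
  have hcov : (range f)ᶜ ⊆ σ.symm '' T ∪ (σ.symm '' (T ∪ X))ᶜ := by
    intro x hx
    by_cases hxT : x ∈ σ.symm '' T
    · exact Or.inl hxT
    · refine Or.inr ?_
      rintro ⟨y, hy | ⟨s, rfl⟩, rfl⟩
      · exact hxT ⟨y, hy, rfl⟩
      · exact hx ⟨s, (σ.left_inv (hfσ s)).symm⟩
  have hqV : q ∈ (σ.symm '' (T ∪ X))ᶜ := by
    rintro ⟨y, -, hy⟩
    have := σ.map_target (htarget y)
    rw [hy, hsource] at this
    exact this rfl
  obtain ⟨x, -, ⟨y, hy, rfl⟩, hx⟩ := hconn _ _ hTo hVo hcov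
    ⟨σ.symm t, hTf t ht, t, ht, rfl⟩ ⟨q, hq, hqV⟩
  exact hx ⟨y, Or.inl hy, rfl⟩

end Sphere

end SurfaceSeparation

/-- Every nonempty compact connected closed surface topologically embedded in the
3-sphere (the unit sphere in 4-dimensional Euclidean space) has disconnected
complement: closed surfaces in `S³` are separating. -/
theorem closed_surface_in_S3_separates
    (S : Type*) [TopologicalSpace S] [T2Space S] [SecondCountableTopology S]
    [ChartedSpace (EuclideanSpace ℝ (Fin 2)) S]
    [Nonempty S] [CompactSpace S] [ConnectedSpace S]
    (f : S → Metric.sphere (0 : EuclideanSpace ℝ (Fin 4)) 1)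
    (hf : Topology.IsEmbedding f) :
    ¬ IsPreconnected ((Set.range f)ᶜ) := by
  exact SurfaceSeparation.not_isPreconnected_compl_range
    SurfaceSeparation.exists_chart_complex hf
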